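/- Suppose F : K → L²(Ω) is Lipschitz and sticking, and assume that Ω_{X̄} ⊆ Ω_{X(t)} for every t ≥ 0 for every Lagrangian solution X starting from data (X̄, V̄) ∈ K × H_{X̄}. Then every Lagrangian solution X starting from data (X̄, V̄) ∈ K × H_{X̄}, with right derivative V(t) = d⁺X/dt(t) existing at every t ≥ 0, is sticky and satisfies the semigroup property: for every τ > 0 the shifted curve t ↦ X(t+τ) is the unique Lagrangian solution with initial data (X(τ), V(τ)). Moreover, for all t ≥ t₁ ≥ 0: X(t) = P_K( X(t₁) + (t−t₁) V(t₁) + ∫_{t₁}^{t} (t−s) F[X(s)] ds ) and V(t) = P_{H_{X(t)}}( V(t₁) + ∫_{t₁}^{t} F[X(s)] ds ). -/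

import Mathlib

open MeasureTheory Set Filter
open scoped ENNReal NNReal RealInnerProductSpace

noncomputable section

/-- The interval `Ω = (0,1)`. -/
def Omg : Set ℝ := Set.Ioo 0 1

/-- Lebesgue measure restricted to `(0,1)`. -/
def mu : Measure ℝ := volume.restrict Omg

/-- The Hilbert space `L²(Ω)`. -/
abbrev L2 : Type := Lp ℝ 2 mu

/-- The cone `K` of functions in `L²(Ω)` admitting a nondecreasing representative. -/
def Kcone : Set L2 := {X | ∃ g : ℝ → ℝ, MonotoneOn g Omg ∧ ⇑X =ᵐ[mu] g}

/-- The normal cone to `K` at `X`. -/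
def normalCone (X : L2) : Set L2 := {W | ∀ Y ∈ Kcone, ⟪W, Y - X⟫ ≤ 0}

/-- `Ω_X`: points of `Ω` near which `X` is (essentially) constant. -/
def OmegaX (X : L2) : Set ℝ :=
  {m | m ∈ Omg ∧ ∃ U ∈ nhds m, ∃ c : ℝ, ∀ᵐ x ∂(mu.restrict U), X x = c}

/-- The closed subspace `H_X` of functions admitting a representative that is constant on
each connected component of `Ω_X`. -/
def HX (X : L2) : Set L2 :=
  {U | ∃ g : ℝ → ℝ, ⇑U =ᵐ[mu] g ∧
    ∀ m ∈ OmegaX X, ∀ m' ∈ connectedComponentIn (OmegaX X) m, g m' = g m}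

/-- `P` is the orthogonal projection of `V` onto `H_X`. -/
def IsProjHX (X V P : L2) : Prop := P ∈ HX X ∧ ∀ U ∈ HX X, ⟪V - P, U⟫ = 0

/-- `P` is the metric projection of `Z` onto `K`. -/
def IsProjK (Z P : L2) : Prop := P ∈ Kcone ∧ ∀ Y ∈ Kcone, ‖P - Z‖ ≤ ‖Y - Z‖

/-- `F` is sticking: for all `X, Y ∈ K` with `Y ∈ H_X`,
`F[X] − P_{H_X}(F[X]) ∈ N_Y K`. -/
def Sticking (F : L2 → L2) : Prop :=
  ∀ X ∈ Kcone, ∀ Y ∈ Kcone, Y ∈ HX X →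
    ∀ P : L2, IsProjHX X (F X) P → F X - P ∈ normalCone Y

/-- A Lagrangian solution with initial data `(X̄, V̄)`. -/
def LagSol (F : L2 → L2) (Xbar Vbar : L2) (X : ℝ → L2) : Prop :=
  (∀ t : ℝ, 0 ≤ t → X t ∈ Kcone) ∧ X 0 = Xbar ∧
  (∀ T : ℝ, ∃ L : ℝ≥0, LipschitzOnWith L X (Set.Icc 0 T)) ∧
  (∀ᵐ t ∂(volume.restrict (Set.Ioi (0:ℝ))),
    ∃ V : L2, HasDerivAt X V t ∧
      (Vbar + ∫ s in Set.Ioc (0:ℝ) t, F (X s)) - V ∈ normalCone (X t))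

/-- A sticky curve: `Ω_{X(t₁)} ⊆ Ω_{X(t₂)}` whenever `0 ≤ t₁ ≤ t₂`. -/
def StickyCurve (X : ℝ → L2) : Prop :=
  ∀ t₁ t₂ : ℝ, 0 ≤ t₁ → t₁ ≤ t₂ → OmegaX (X t₁) ⊆ OmegaX (X t₂)

open scoped Topology

/-- An absolutely continuous function with a.e. nonpositive derivative does not increase. -/
theorem AbsolutelyContinuousOnInterval.le_of_ae_hasDerivAt_nonpos {f : ℝ → ℝ} {a b : ℝ}
    (hab : a ≤ b) (hf : AbsolutelyContinuousOnInterval f a b)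
    (h : ∀ᵐ t, t ∈ Ioo a b → ∃ d ≤ 0, HasDerivAt f d t) : f b ≤ f a := by
  have h1 := hf.integral_deriv_eq_sub
  have h2 : ∫ x in a..b, deriv f x ≤ 0 := by
    rw [intervalIntegral.integral_of_le hab]
    refine integral_nonpos_of_ae ?_
    rw [Filter.EventuallyLE, ae_restrict_iff' measurableSet_Ioc]
    have hb : ∀ᵐ t : ℝ, t ≠ b := by simp [ae_iff, measure_singleton]
    filter_upwards [h, hb] with t ht htb hm
    obtain ⟨d, hd, hd'⟩ := ht ⟨hm.1, lt_of_le_of_ne hm.2 htb⟩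
    rw [hd'.deriv]; exact hd
  linarith

/-- Grönwall's inequality for an absolutely continuous function. -/
theorem AbsolutelyContinuousOnInterval.le_exp_mul_of_ae_hasDerivAt_le {φ : ℝ → ℝ} {c T : ℝ}
    (hT : 0 ≤ T) (hφ : AbsolutelyContinuousOnInterval φ 0 T)
    (h : ∀ᵐ t, t ∈ Ioo 0 T → ∃ d ≤ c * φ t, HasDerivAt φ d t) :
    φ T ≤ Real.exp (c * T) * φ 0 := by
  have hexp : AbsolutelyContinuousOnInterval (fun t : ℝ => Real.exp (-(c * t))) 0 T := by
    apply ContDiffOn.absolutelyContinuousOnInterval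
    fun_prop
  have := (hexp.mul hφ).le_of_ae_hasDerivAt_nonpos hT ?_
  · simp only [Pi.mul_apply, mul_zero, neg_zero, Real.exp_zero, one_mul] at this
    calc φ T = Real.exp (c * T) * (Real.exp (-(c * T)) * φ T) := by
          rw [← mul_assoc, ← Real.exp_add]; simp
      _ ≤ _ := by gcongr
  · filter_upwards [h] with t ht hm
    obtain ⟨d, hd, hd'⟩ := ht hm
    have h1 : HasDerivAt (fun t : ℝ => Real.exp (-(c * t))) (Real.exp (-(c * t)) * (-c)) t := by
      have := ((hasDerivAt_id t).const_mul c).neg.exp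
      simpa using this
    refine ⟨_, ?_, h1.mul hd'⟩
    have := Real.exp_pos (-(c * t))
    nlinarith

/-- Grönwall's inequality for an everywhere differentiable function with a constant source. -/
theorem le_exp_mul_of_hasDerivAt_le {φ φ' : ℝ → ℝ} {c e T : ℝ} (hc : 0 ≤ c) (he : 0 ≤ e)
    (hT : 0 ≤ T) (hφ : ∀ t ∈ Icc 0 T, HasDerivAt φ (φ' t) t)
    (h : ∀ t ∈ Icc 0 T, φ' t ≤ c * φ t + e) :
    φ T ≤ Real.exp (c * T) * (φ 0 + e * T) := by
  have key : AntitoneOn (fun t : ℝ => Real.exp (-(c * t)) * φ t - e * t) (Icc 0 T) := by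
    have hd : ∀ t ∈ Icc 0 T, HasDerivAt (fun t : ℝ => Real.exp (-(c * t)) * φ t - e * t)
        (Real.exp (-(c * t)) * (-c) * φ t + Real.exp (-(c * t)) * φ' t - e) t := by
      intro t ht
      have h1 : HasDerivAt (fun t : ℝ => Real.exp (-(c * t))) (Real.exp (-(c * t)) * (-c)) t := by
        have := ((hasDerivAt_id t).const_mul c).neg.exp
        simpa using this
      simpa using! (h1.mul (hφ t ht)).sub ((hasDerivAt_id t).const_mul e)
    refine antitoneOn_of_deriv_nonpos (convex_Icc _ _)
      (fun t ht => (hd t ht).continuousAt.continuousWithinAt)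
      (fun t ht => (hd t (interior_subset ht)).differentiableAt.differentiableWithinAt) ?_
    intro t ht
    have ht' := interior_subset ht
    rw [(hd t ht').deriv]
    have h2 := h t ht'
    have h3 := Real.exp_pos (-(c * t))
    have h4 : Real.exp (-(c * t)) ≤ 1 := by
      rw [Real.exp_le_one_iff]; nlinarith [ht'.1]
    nlinarith
  have := key (left_mem_Icc.2 hT) (right_mem_Icc.2 hT) hT
  simp only [mul_zero, neg_zero, Real.exp_zero, one_mul, sub_zero] at this
  calc φ T = Real.exp (c * T) * (Real.exp (-(c * T)) * φ T) := by
        rw [← mul_assoc, ← Real.exp_add]; simp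
    _ ≤ _ := by gcongr; linarith

section Rademacher

variable {E : Type*} [NormedAddCommGroup E] [InnerProductSpace ℝ E]

theorem norm_le_of_abs_inner_le_of_dense {d : ℕ → E} (hd : DenseRange d) {x : E} {m : ℝ}
    (hm : 0 ≤ m) (h : ∀ n, |⟪d n, x⟫| ≤ ‖d n‖ * m) : ‖x‖ ≤ m := by
  have hx : |⟪x, x⟫| ≤ ‖x‖ * m := by
    refine hd.induction_on (p := fun y => |⟪y, x⟫| ≤ ‖y‖ * m) x ?_ h
    exact isClosed_le (by fun_prop) (by fun_prop)
  rw [real_inner_self_eq_norm_sq, abs_of_nonneg (by positivity)] at hx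
  rcases (norm_nonneg x).eq_or_lt with h0 | h0
  · rw [← h0]; exact hm
  · nlinarith

/-- If all directional slopes of `q` have limits along `l`, and `‖q‖` is asymptotically bounded by
the supremum of those limits, then `q` is Cauchy along `l`. -/
theorem cauchy_map_of_inner_tendsto {ι : Type*} {l : Filter ι} [l.NeBot] {q : ι → E} {m : ℝ}
    (hm : 0 ≤ m) (hq : ∀ ε > 0, ∀ᶠ i in l, ‖q i‖ ≤ m + ε)
    (hw : ∀ ε > 0, ∃ e : E, ‖e‖ ≤ 1 ∧ ∀ᶠ i in l, m - ε ≤ ⟪e, q i⟫) : Cauchy (map q l) := by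
  refine ⟨inferInstance, ?_⟩
  rw [Filter.prod_map_map_eq, Metric.uniformity_basis_dist.ge_iff]
  intro ε hε
  set η := min 1 (ε ^ 2 / (16 * (2 * m + 1) + 1)) with hη
  have hη0 : 0 < η := by positivity
  have hη1 : η ≤ 1 := min_le_left _ _
  have hη2 : η * (16 * (2 * m + 1) + 1) ≤ ε ^ 2 := by
    rw [← le_div_iff₀ (by positivity)]; exact min_le_right _ _
  obtain ⟨e, he, hw⟩ := hw η hη0
  have h1 := (hq η hη0).and hw
  rw [Filter.mem_map]
  filter_upwards [h1.prod_mk h1] with ⟨i, j⟩ ⟨⟨hi, hi'⟩, hj, hj'⟩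
  simp only [mem_preimage, mem_ofPred_eq, dist_eq_norm]
  have hpar := parallelogram_law_with_norm ℝ (q i) (q j)
  have hsum : 2 * (m - η) ≤ ‖q i + q j‖ := by
    have : ⟪e, q i + q j⟫ ≤ ‖e‖ * ‖q i + q j‖ := real_inner_le_norm _ _
    rw [inner_add_right] at this
    nlinarith [norm_nonneg (q i + q j)]
  have h0 := norm_nonneg (q i)
  have h0' := norm_nonneg (q j)
  have h0'' := norm_nonneg (q i + q j)
  have hi2 : ‖q i‖ * ‖q i‖ ≤ (m + η) * (m + η) := by gcongr
  have hj2 : ‖q j‖ * ‖q j‖ ≤ (m + η) * (m + η) := by gcongr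
  have hs2 : 4 * m ^ 2 - 8 * m * η ≤ ‖q i + q j‖ * ‖q i + q j‖ := by
    rcases le_total 0 (m - η) with h | h
    · nlinarith
    · nlinarith
  have : ‖q i - q j‖ ^ 2 < ε ^ 2 := by nlinarith
  exact lt_of_pow_lt_pow_left₀ 2 hε.le this

/-- Rademacher's theorem for Lipschitz curves in a separable Hilbert space. -/
theorem LipschitzWith.ae_differentiableAt_of_hilbert [CompleteSpace E]
    [SecondCountableTopology E] {C : ℝ≥0} {u : ℝ → E} (hu : LipschitzWith C u) :
    ∀ᵐ t, DifferentiableAt ℝ u t := by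
  set d : ℕ → E := TopologicalSpace.denseSeq E
  have hdd : DenseRange d := TopologicalSpace.denseRange_denseSeq E
  have hlip : ∀ e : E, LipschitzWith (‖e‖₊ * C) (fun t => ⟪e, u t⟫) := fun e =>
    ((innerSL ℝ e).lipschitz.comp hu).weaken (by
      gcongr
      rw [← NNReal.coe_le_coe]; simp)
  set a : ℕ → ℝ → ℝ := fun n t => deriv (fun s => ⟪d n, u s⟫) t with ha
  have ha_le : ∀ n t, |a n t| ≤ ‖d n‖ * C := fun n t => by
    simpa using norm_deriv_le_of_lipschitz (hlip (d n)) (x₀ := t)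
  set b : ℕ → ℝ → ℝ := fun n t => |a n t| / ‖d n‖ with hb
  have hb_le : ∀ n t, b n t ≤ C := fun n t => by
    rcases (norm_nonneg (d n)).eq_or_lt with h | h
    · simp [hb, ← h]
    · rw [hb, div_le_iff₀ h, mul_comm]; exact ha_le n t
  have hbdd : ∀ t, BddAbove (range fun n => b n t) := fun t => ⟨C, by
    rintro _ ⟨n, rfl⟩; exact hb_le n t⟩
  set m : ℝ → ℝ := fun t => ⨆ n, b n t with hm
  have hb0 : ∀ n t, 0 ≤ b n t := fun n t => by positivity
  have hm0 : ∀ t, 0 ≤ m t := fun t => Real.iSup_nonneg fun n => hb0 n t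
  have hmC : ∀ t, m t ≤ C := fun t => ciSup_le fun n => hb_le n t
  have ham : ∀ n t, |a n t| ≤ ‖d n‖ * m t := fun n t => by
    rcases (norm_nonneg (d n)).eq_or_lt with h | h
    · have := ha_le n t
      rw [← h] at this ⊢; simpa using this
    · rw [mul_comm, ← div_le_iff₀ h]; exact le_ciSup (hbdd t) n
  have hmeas : Measurable m :=
    Measurable.iSup fun n => ((measurable_deriv _).abs).div_const _
  have hmloc : LocallyIntegrable m volume := by
    refine LocallyIntegrable.mono (locallyIntegrable_const (C : ℝ)) hmeas.aestronglyMeasurable ?_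
    refine .of_forall fun t => ?_
    rw [Real.norm_of_nonneg (hm0 t)]; simpa using hmC t
  have hmi : ∀ s t, IntervalIntegrable m volume s t := fun s t =>
    (hmloc.integrableOn_isCompact isCompact_uIcc).intervalIntegrable
  have hincr : ∀ s t, s ≤ t → ‖u t - u s‖ ≤ ∫ r in s..t, m r := by
    intro s t hst
    refine norm_le_of_abs_inner_le_of_dense hdd
      (intervalIntegral.integral_nonneg hst fun r _ => hm0 r) fun n => ?_
    have hac : AbsolutelyContinuousOnInterval (fun t => ⟪d n, u t⟫) s t :=
      (hlip (d n)).lipschitzOnWith.absolutelyContinuousOnInterval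
    rw [inner_sub_right, ← hac.integral_deriv_eq_sub, ← intervalIntegral.integral_const_mul,
      ← Real.norm_eq_abs]
    refine intervalIntegral.norm_integral_le_of_norm_le hst (.of_forall fun r _ => ham n r)
      ((hmi s t).const_mul _)
  have hdiff : ∀ᵐ t, ∀ n, DifferentiableAt ℝ (fun s => ⟪d n, u s⟫) t :=
    ae_all_iff.2 fun n => (hlip (d n)).ae_differentiableAt_real
  filter_upwards [hdiff, _root_.LocallyIntegrable.ae_hasDerivAt_integral hmloc] with t hdt hmt
  have hslope := (hmt 0).tendsto_slope
  have hnorm : ∀ s, s ≠ t → ‖slope u t s‖ ≤ slope (fun x => ∫ r in (0:ℝ)..x, m r) t s := by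
    intro s hs
    rw [slope_def_module, slope_def_field, norm_smul,
      intervalIntegral.integral_interval_sub_left (hmi _ _) (hmi _ _)]
    rcases lt_or_gt_of_ne hs with h | h
    · have := hincr s t h.le
      rw [intervalIntegral.integral_symm, norm_inv, Real.norm_of_nonpos (by linarith),
        norm_sub_rev, ← neg_sub t s, div_neg, neg_div, neg_neg, neg_neg, inv_mul_eq_div]
      have : 0 < t - s := by linarith
      gcongr
    · have := hincr t s h.le
      rw [norm_inv, Real.norm_of_nonneg (by linarith), inv_mul_eq_div]
      have : 0 < s - t := by linarith
      gcongr
  have hcau : Cauchy (map (slope u t) (𝓝[≠] t)) := by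
    refine cauchy_map_of_inner_tendsto (hm0 t) (fun ε hε => ?_) fun ε hε => ?_
    · filter_upwards [hslope.eventually_le_const (u := m t + ε) (by linarith), self_mem_nhdsWithin]
        with s hs hst
      exact (hnorm s hst).trans hs
    · obtain ⟨n, hn⟩ := exists_lt_of_lt_ciSup (show m t - ε / 2 < ⨆ n, b n t by
        change m t - ε / 2 < m t; linarith)
      rcases (norm_nonneg (d n)).eq_or_lt with h | h
      · refine ⟨0, by simp, .of_forall fun i => ?_⟩
        simp only [hb, ← h, div_zero] at hn
        simp; linarith
      obtain ⟨σ, hσ, hσ'⟩ : ∃ σ : ℝ, |σ| = 1 ∧ σ * a n t = |a n t| := by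
        rcases le_total 0 (a n t) with h | h
        · exact ⟨1, by simp, by simp [abs_of_nonneg h]⟩
        · exact ⟨-1, by simp, by simp [abs_of_nonpos h]⟩
      refine ⟨(σ / ‖d n‖) • d n, ?_, ?_⟩
      · rw [norm_smul, norm_div, Real.norm_eq_abs, hσ, norm_norm]
        field_simp; exact le_rfl
      · have h1 : Tendsto (fun s => ⟪(σ / ‖d n‖) • d n, slope u t s⟫) (𝓝[≠] t) (𝓝 (b n t)) := by
          have h2 := ((hdt n).hasDerivAt.tendsto_slope).const_mul (σ / ‖d n‖)
          have h3 : σ / ‖d n‖ * a n t = b n t := by simp only [hb]; rw [← hσ']; ring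
          rw [← h3]
          refine h2.congr fun s => ?_
          simp only [slope_def_module, inner_smul_left, inner_smul_right,
            inner_sub_right]
          simp; ring
        filter_upwards [h1.eventually_const_le (u := m t - ε) (by linarith)] with s hs using hs
  obtain ⟨v, hv⟩ := cauchy_map_iff_exists_tendsto.1 hcau
  exact (hasDerivAt_iff_tendsto_slope.2 hv).differentiableAt

end Rademacher

section GlobalODE

variable {B : Type*} [NormedAddCommGroup B] [NormedSpace ℝ B]

theorem norm_exp_smul_integral_le {g : ℝ → B} {k α t : ℝ} (hα : 0 < α) (hk : 0 ≤ k)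
    (ht : 0 ≤ t) (hgk : ∀ s, 0 ≤ s → ‖g s‖ ≤ k * Real.exp (α * s)) :
    ‖Real.exp (-(α * t)) • ∫ s in (0:ℝ)..t, g s‖ ≤ k / α := by
  have hd : ∀ s : ℝ, HasDerivAt (fun s => k / α * Real.exp (α * s)) (k * Real.exp (α * s)) s := by
    intro s
    have := (((hasDerivAt_id s).const_mul α).exp).const_mul (k / α)
    refine this.congr_deriv ?_
    simp only [id, mul_one]; field_simp
  have hc : Continuous fun s : ℝ => k * Real.exp (α * s) := by fun_prop
  have h1 : ‖∫ s in (0:ℝ)..t, g s‖ ≤ ∫ s in (0:ℝ)..t, k * Real.exp (α * s) := by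
    refine intervalIntegral.norm_integral_le_of_norm_le ht ?_ (hc.intervalIntegrable _ _)
    exact .of_forall fun s hs => hgk s hs.1.le
  rw [intervalIntegral.integral_eq_sub_of_hasDerivAt (fun s _ => hd s)
    (hc.intervalIntegrable _ _)] at h1
  rw [norm_smul, Real.norm_of_nonneg (Real.exp_pos _).le]
  calc Real.exp (-(α * t)) * ‖∫ s in (0:ℝ)..t, g s‖
      ≤ Real.exp (-(α * t)) * (k / α * Real.exp (α * t)) := by
        gcongr
        have : 0 ≤ k / α := by positivity
        simp at h1; linarith
    _ = k / α := by
        rw [mul_comm, mul_assoc, ← Real.exp_add]; simp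

/-- Global forward solvability of an autonomous ODE with Lipschitz right-hand side. -/
theorem exists_forall_hasDerivAt_of_lipschitz [CompleteSpace B] {f : B → B} {M : ℝ≥0}
    (hf : LipschitzWith M f) (z₀ : B) :
    ∃ z : ℝ → B, z 0 = z₀ ∧ ∀ t, 0 ≤ t → HasDerivAt z (f (z t)) t := by
  set α : ℝ := M + 1 with hα
  have hα0 : 0 < α := by positivity
  have hcont : ∀ w : BoundedContinuousFunction ℝ B,
      Continuous fun s : ℝ => f (Real.exp (α * s) • w s) := fun w =>
    hf.continuous.comp (by fun_prop)
  have hprim : ∀ w : BoundedContinuousFunction ℝ B,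
      Continuous fun t : ℝ => ∫ s in (0:ℝ)..t, f (Real.exp (α * s) • w s) := fun w =>
    intervalIntegral.continuous_primitive (fun a b => (hcont w).intervalIntegrable a b) 0
  have hbd : ∀ w : BoundedContinuousFunction ℝ B, ∀ s, 0 ≤ s →
      ‖f (Real.exp (α * s) • w s)‖ ≤ (‖f 0‖ + M * ‖w‖) * Real.exp (α * s) := by
    intro w s hs
    have h1 : ‖f (Real.exp (α * s) • w s) - f 0‖ ≤ M * ‖Real.exp (α * s) • w s - 0‖ :=
      hf.norm_sub_le _ _
    have h2 := norm_le_norm_add_norm_sub' (f (Real.exp (α * s) • w s)) (f 0)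
    rw [sub_zero, norm_smul, Real.norm_of_nonneg (Real.exp_pos _).le] at h1
    have h3 : 1 ≤ Real.exp (α * s) := Real.one_le_exp (by positivity)
    have h4 : (M:ℝ) * (Real.exp (α * s) * ‖w s‖) ≤ M * (Real.exp (α * s) * ‖w‖) := by
      gcongr; exact w.norm_coe_le_norm s
    nlinarith [norm_nonneg (f 0)]
  let Φ : BoundedContinuousFunction ℝ B → BoundedContinuousFunction ℝ B := fun w =>
    BoundedContinuousFunction.ofNormedAddCommGroup
      (fun t => Real.exp (-(α * max t 0)) •
        (z₀ + ∫ s in (0:ℝ)..(max t 0), f (Real.exp (α * s) • w s)))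
      (by
        have := (hprim w).comp (show Continuous fun t : ℝ => max t 0 by fun_prop)
        simp only [Function.comp_def] at this
        fun_prop)
      (‖z₀‖ + (‖f 0‖ + M * ‖w‖) / α) (by
        intro t
        rw [smul_add]
        refine (norm_add_le _ _).trans ?_
        gcongr
        · rw [norm_smul, Real.norm_of_nonneg (Real.exp_pos _).le]
          refine mul_le_of_le_one_left (norm_nonneg _) ?_
          rw [Real.exp_le_one_iff]
          have := le_max_right t 0
          nlinarith
        · exact norm_exp_smul_integral_le hα0 (by positivity) (le_max_right _ _) (hbd w))
  have hΦ : ∀ w t, Φ w t = Real.exp (-(α * max t 0)) •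
        (z₀ + ∫ s in (0:ℝ)..(max t 0), f (Real.exp (α * s) • w s)) := fun w t => rfl
  have hlip : LipschitzWith (M / (M + 1)) Φ := by
    refine LipschitzWith.of_dist_le_mul fun w w' => ?_
    rw [BoundedContinuousFunction.dist_le (by positivity)]
    intro t
    rw [hΦ, hΦ, dist_eq_norm, ← smul_sub, add_sub_add_left_eq_sub,
      ← intervalIntegral.integral_sub ((hcont w).intervalIntegrable _ _)
        ((hcont w').intervalIntegrable _ _)]
    refine (norm_exp_smul_integral_le (k := M * dist w w') hα0 (by positivity)
      (le_max_right _ _) ?_).trans ?_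
    · intro s hs
      refine (hf.norm_sub_le _ _).trans ?_
      rw [← smul_sub, norm_smul, Real.norm_of_nonneg (Real.exp_pos _).le, ← dist_eq_norm]
      have := BoundedContinuousFunction.dist_coe_le_dist (f := w) (g := w') s
      have h5 : (M:ℝ) * (Real.exp (α * s) * dist (w s) (w' s)) ≤
        M * (Real.exp (α * s) * dist w w') := by gcongr
      linarith
    · simp [hα]
      apply le_of_eq; ring
  have hcontr : ContractingWith (M / (M + 1)) Φ := by
    refine ⟨?_, hlip⟩
    rw [div_lt_one (by positivity)]
    exact lt_add_one M
  set w := hcontr.fixedPoint with hw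
  have hfix : Φ w = w := hcontr.fixedPoint_isFixedPt
  refine ⟨fun t => z₀ + ∫ s in (0:ℝ)..t, f (Real.exp (α * s) • w s), by simp, fun t ht => ?_⟩
  have h1 : Real.exp (α * t) • w t = z₀ + ∫ s in (0:ℝ)..t, f (Real.exp (α * s) • w s) := by
    conv_lhs => rw [← hfix, hΦ, max_eq_left ht, smul_smul, ← Real.exp_add]
    simp
  have h2 := ((hcont w).integral_hasStrictDerivAt 0 t).hasDerivAt.const_add z₀
  rw [h1] at h2; exact h2

end GlobalODE

section Evolution

variable {E : Type*} [NormedAddCommGroup E] [InnerProductSpace ℝ E]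

theorem norm_sub_le_of_isProj {K : Set E} {P : E → E} (hPK : ∀ x, P x ∈ K)
    (hP : ∀ x, ∀ z ∈ K, ⟪x - P x, z - P x⟫ ≤ 0) (x y : E) : ‖P x - P y‖ ≤ ‖x - y‖ := by
  have h1 := hP x _ (hPK y)
  have h2 := hP y _ (hPK x)
  have h3 : ‖P x - P y‖ ^ 2 ≤ ⟪x - y, P x - P y⟫ := by
    rw [← real_inner_self_eq_norm_sq]
    simp only [inner_sub_left, inner_sub_right, real_inner_comm] at *
    linarith
  have h4 := real_inner_le_norm (x - y) (P x - P y)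
  rcases (norm_nonneg (P x - P y)).eq_or_lt with h | h
  · rw [← h]; positivity
  · nlinarith

theorem inner_sub_nonneg_of_isProj {K : Set E} {P : E → E} (hPK : ∀ x, P x ∈ K)
    (hP : ∀ x, ∀ z ∈ K, ⟪x - P x, z - P x⟫ ≤ 0) (x y : E) :
    0 ≤ ⟪(x - P x) - (y - P y), P x - P y⟫ := by
  have h1 := hP x _ (hPK y)
  have h2 := hP y _ (hPK x)
  simp only [inner_sub_left, inner_sub_right, real_inner_comm] at *
  linarith

theorem inner_resolvent_sub_le {K : Set E} {P : E → E} (hPK : ∀ x, P x ∈ K)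
    (hP : ∀ x, ∀ z ∈ K, ⟪x - P x, z - P x⟫ ≤ 0) {l m b : ℝ} (hl : 0 < l) (hm : 0 < m)
    {x y : E} (hx : ‖l⁻¹ • (x - P x)‖ ≤ b) (hy : ‖m⁻¹ • (y - P y)‖ ≤ b) :
    -(l + m) * b ^ 2 ≤ ⟪l⁻¹ • (x - P x) - m⁻¹ • (y - P y), x - y⟫ := by
  set a := l⁻¹ • (x - P x) with ha
  set c := m⁻¹ • (y - P y) with hc
  have hx' : x = P x + l • a := by rw [ha, smul_smul, mul_inv_cancel₀ hl.ne']; simp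
  have hy' : y = P y + m • c := by rw [hc, smul_smul, mul_inv_cancel₀ hm.ne']; simp
  have h1 : ⟪a, P y - P x⟫ ≤ 0 := by
    rw [ha, inner_smul_left]
    exact mul_nonpos_of_nonneg_of_nonpos (by simp [hl.le]) (hP x _ (hPK y))
  have h2 : ⟪c, P x - P y⟫ ≤ 0 := by
    rw [hc, inner_smul_left]
    exact mul_nonpos_of_nonneg_of_nonpos (by simp [hm.le]) (hP y _ (hPK x))
  have h3 : ⟪a - c, x - y⟫ = -⟪a, P y - P x⟫ - ⟪c, P x - P y⟫ + l * ‖a‖ ^ 2 + m * ‖c‖ ^ 2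
      - (l + m) * ⟪a, c⟫ := by
    rw [← real_inner_self_eq_norm_sq, ← real_inner_self_eq_norm_sq]
    conv_lhs => rw [hx', hy']
    simp only [inner_sub_left, inner_sub_right, inner_add_right, inner_smul_right,
      real_inner_comm a c]
    ring
  have h4 : ⟪a, c⟫ ≤ b ^ 2 := by
    refine (real_inner_le_norm a c).trans ?_
    rw [sq]; gcongr
    exact (norm_nonneg _).trans hx
  nlinarith [sq_nonneg ‖a‖, sq_nonneg ‖c‖, mul_le_mul_of_nonneg_left h4 (add_pos hl hm).le,
    mul_nonneg hl.le (sq_nonneg ‖a‖), mul_nonneg hm.le (sq_nonneg ‖c‖)]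

theorem exists_yosida [CompleteSpace E] {K : Set E} {P : E → E} (hPK : ∀ x, P x ∈ K)
    (hP : ∀ x, ∀ z ∈ K, ⟪x - P x, z - P x⟫ ≤ 0) {G : E → E} {L : ℝ≥0}
    (hG : LipschitzWith L G) (l : ℝ) (x v : E) :
    ∃ u y : ℝ → E, u 0 = x ∧ y 0 = v ∧
      (∀ t, 0 ≤ t → HasDerivAt u (y t - l⁻¹ • (u t - P (u t))) t) ∧
      (∀ t, 0 ≤ t → HasDerivAt y (G (u t)) t) := by
  have hPlip : LipschitzWith 1 P := LipschitzWith.of_dist_le_mul fun a b => by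
    simpa [dist_eq_norm] using norm_sub_le_of_isProj hPK hP a b
  obtain ⟨M, hM⟩ : ∃ M, LipschitzWith M
      (fun z : E × E => (z.2 - l⁻¹ • (z.1 - P z.1), G z.1)) := by
    have h1 : LipschitzWith _ (fun z : E × E => z.1 - P z.1) :=
      LipschitzWith.prod_fst.sub (hPlip.comp LipschitzWith.prod_fst)
    have h2 : LipschitzWith _ (fun z : E × E => l⁻¹ • (z.1 - P z.1)) :=
      (lipschitzWith_smul l⁻¹).comp h1
    exact ⟨_, (LipschitzWith.prod_snd.sub h2).prodMk (hG.comp LipschitzWith.prod_fst)⟩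
  obtain ⟨z, hz0, hz⟩ := exists_forall_hasDerivAt_of_lipschitz hM (x, v)
  refine ⟨fun t => (z t).1, fun t => (z t).2, by simp [hz0], by simp [hz0], ?_, ?_⟩
  · intro t ht
    exact (hz t ht).fst
  · intro t ht
    exact (hz t ht).snd

/-- Exponential bound for the velocity of the regularized system, uniform in `l`. -/
theorem norm_sq_deriv_le_of_yosida {K : Set E} {P : E → E} (hPK : ∀ x, P x ∈ K)
    (hP : ∀ x, ∀ z ∈ K, ⟪x - P x, z - P x⟫ ≤ 0) {G : E → E} {L : ℝ≥0}
    (hG : LipschitzWith L G) {l : ℝ} (hl : 0 < l) {u y : ℝ → E}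
    (hu : ∀ t, 0 ≤ t → HasDerivAt u (y t - l⁻¹ • (u t - P (u t))) t)
    (hy : ∀ t, 0 ≤ t → HasDerivAt y (G (u t)) t) {t : ℝ} (ht : 0 ≤ t) :
    ‖y t - l⁻¹ • (u t - P (u t))‖ ^ 2 + ‖G (u t)‖ ^ 2 ≤
      Real.exp ((1 + L) * t) *
        (‖y 0 - l⁻¹ • (u 0 - P (u 0))‖ ^ 2 + ‖G (u 0)‖ ^ 2) := by
  have hmono : ∀ a b : E, 0 ≤ ⟪l⁻¹ • (a - P a) - l⁻¹ • (b - P b), a - b⟫ := by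
    intro a b
    rw [← smul_sub, inner_smul_left]
    refine mul_nonneg (by simp [hl.le]) ?_
    have h1 := inner_sub_nonneg_of_isProj hPK hP a b
    have h2 : ⟪a - P a - (b - P b), a - b⟫ = ‖a - P a - (b - P b)‖ ^ 2 +
        ⟪(a - P a) - (b - P b), P a - P b⟫ := by
      rw [← real_inner_self_eq_norm_sq, ← inner_add_right]; congr 1; abel
    rw [h2]; positivity
  have key : ∀ h, 0 < h → ‖u (t + h) - u t‖ ^ 2 + ‖y (t + h) - y t‖ ^ 2 ≤
      Real.exp ((1 + L) * t) * (‖u (0 + h) - u 0‖ ^ 2 + ‖y (0 + h) - y 0‖ ^ 2) := by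
    intro h hh
    have hd : ∀ s ∈ Icc 0 t, HasDerivAt
        (fun s => ‖u (s + h) - u s‖ ^ 2 + ‖y (s + h) - y s‖ ^ 2)
        (2 * ⟪u (s + h) - u s, (y (s + h) - l⁻¹ • (u (s + h) - P (u (s + h)))) -
          (y s - l⁻¹ • (u s - P (u s)))⟫ +
          2 * ⟪y (s + h) - y s, G (u (s + h)) - G (u s)⟫) s := by
      intro s hs
      have h1 := ((hu (s + h) (by linarith [hs.1])).comp_add_const s h).sub (hu s hs.1)
      have h2 := ((hy (s + h) (by linarith [hs.1])).comp_add_const s h).sub (hy s hs.1)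
      exact h1.norm_sq.add h2.norm_sq
    have := le_exp_mul_of_hasDerivAt_le (c := 1 + L) (e := 0) (by positivity) le_rfl ht hd ?_
    · simpa using this
    · intro s hs
      have h1 := hmono (u (s + h)) (u s)
      have h2 : ⟪u (s + h) - u s, y (s + h) - y s⟫ ≤ ‖u (s + h) - u s‖ * ‖y (s + h) - y s‖ :=
        real_inner_le_norm _ _
      have h3 : ⟪y (s + h) - y s, G (u (s + h)) - G (u s)⟫ ≤
          ‖y (s + h) - y s‖ * (L * ‖u (s + h) - u s‖) :=
        (real_inner_le_norm _ _).trans (by gcongr; exact hG.norm_sub_le _ _)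
      have h4 : ⟪u (s + h) - u s, (y (s + h) - l⁻¹ • (u (s + h) - P (u (s + h)))) -
          (y s - l⁻¹ • (u s - P (u s)))⟫ = ⟪u (s + h) - u s, y (s + h) - y s⟫ -
          ⟪l⁻¹ • (u (s + h) - P (u (s + h))) - l⁻¹ • (u s - P (u s)), u (s + h) - u s⟫ := by
        rw [real_inner_comm (u (s + h) - u s) (l⁻¹ • (u (s + h) - P (u (s + h))) -
          l⁻¹ • (u s - P (u s))), ← inner_sub_right]
        congr 1; abel
      rw [h4]
      have h5 : (0:ℝ) ≤ L := L.2
      nlinarith [mul_nonneg h5 (sq_nonneg (‖u (s + h) - u s‖ - ‖y (s + h) - y s‖)),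
        sq_nonneg (‖u (s + h) - u s‖ - ‖y (s + h) - y s‖)]
  have hlim : ∀ s, 0 ≤ s → Tendsto
      (fun h : ℝ => ‖h⁻¹ • (u (s + h) - u s)‖ ^ 2 + ‖h⁻¹ • (y (s + h) - y s)‖ ^ 2) (𝓝[>] 0)
      (𝓝 (‖y s - l⁻¹ • (u s - P (u s))‖ ^ 2 + ‖G (u s)‖ ^ 2)) := by
    intro s hs
    have h1 := (hasDerivAt_iff_tendsto_slope_zero.1 (hu s hs)).mono_left
      (nhdsWithin_mono _ (fun h (hh : 0 < h) => hh.ne'))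
    have h2 := (hasDerivAt_iff_tendsto_slope_zero.1 (hy s hs)).mono_left
      (nhdsWithin_mono _ (fun h (hh : 0 < h) => hh.ne'))
    exact (h1.norm.pow 2).add (h2.norm.pow 2)
  refine le_of_tendsto_of_tendsto (hlim t ht) ((hlim 0 le_rfl).const_mul _) ?_
  filter_upwards [self_mem_nhdsWithin] with h hh
  have := key h hh
  simp only [norm_smul, mul_pow, ← mul_add]
  rw [mul_left_comm]
  gcongr

/-- Uniform bounds for the regularized system on bounded time intervals. -/
theorem exists_bound_of_yosida {K : Set E} {P : E → E} (hPK : ∀ x, P x ∈ K)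
    (hP : ∀ x, ∀ z ∈ K, ⟪x - P x, z - P x⟫ ≤ 0) {G : E → E} {L : ℝ≥0}
    (hG : LipschitzWith L G) {x : E} (hx : x ∈ K) (v : E) (T : ℝ) :
    ∃ b : ℝ, 0 ≤ b ∧ ∀ (l : ℝ) (_ : 0 < l) (u y : ℝ → E) (_ : u 0 = x) (_ : y 0 = v)
      (_ : ∀ t, 0 ≤ t → HasDerivAt u (y t - l⁻¹ • (u t - P (u t))) t)
      (_ : ∀ t, 0 ≤ t → HasDerivAt y (G (u t)) t) (t : ℝ) (_ : t ∈ Icc 0 T),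
      ‖y t - l⁻¹ • (u t - P (u t))‖ ≤ b ∧ ‖G (u t)‖ ≤ b ∧ ‖y t‖ ≤ b ∧
        ‖l⁻¹ • (u t - P (u t))‖ ≤ b ∧ ‖u t‖ ≤ b := by
  have hPx : x - P x = 0 := by
    have h := hP x x hx
    rw [real_inner_self_eq_norm_sq] at h
    exact norm_eq_zero.1 (pow_eq_zero_iff two_ne_zero |>.1 (le_antisymm h (by positivity)))
  set S : ℝ := Real.sqrt (Real.exp ((1 + L) * T) * (‖v‖ ^ 2 + ‖G x‖ ^ 2)) with hS
  have hS0 : 0 ≤ S := Real.sqrt_nonneg _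
  set b : ℝ := ‖x‖ + ‖v‖ + |T| * S + S with hb
  have hTS : 0 ≤ |T| * S := by positivity
  refine ⟨b, by positivity, fun l hl u y hu0 hy0 hu hy => ?_⟩
  have h1 : ∀ t ∈ Icc 0 T, ‖y t - l⁻¹ • (u t - P (u t))‖ ^ 2 + ‖G (u t)‖ ^ 2 ≤ S ^ 2 := by
    intro t ht
    refine (norm_sq_deriv_le_of_yosida hPK hP hG hl hu hy ht.1).trans ?_
    rw [hS, Real.sq_sqrt (by positivity), hu0, hy0, hPx, smul_zero, sub_zero]
    gcongr; exact ht.2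
  have h2 : ∀ t ∈ Icc 0 T, ‖y t - l⁻¹ • (u t - P (u t))‖ ≤ S := fun t ht =>
    abs_le_of_sq_le_sq' (by nlinarith [h1 t ht, sq_nonneg ‖G (u t)‖]) hS0 |>.2
  have h3 : ∀ t ∈ Icc 0 T, ‖G (u t)‖ ≤ S := fun t ht =>
    abs_le_of_sq_le_sq' (by nlinarith [h1 t ht, sq_nonneg ‖y t - l⁻¹ • (u t - P (u t))‖]) hS0 |>.2
  have hincr : ∀ w w' : ℝ → E, (∀ t, 0 ≤ t → HasDerivAt w (w' t) t) →
      (∀ t ∈ Icc 0 T, ‖w' t‖ ≤ S) → ∀ t ∈ Icc 0 T, ‖w t‖ ≤ ‖w 0‖ + |T| * S := by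
    intro w w' hw hw' t ht
    have h := (convex_Icc (0:ℝ) T).norm_image_sub_le_of_norm_hasDerivWithin_le
      (fun s hs => (hw s hs.1).hasDerivWithinAt) hw' (left_mem_Icc.2 (ht.1.trans ht.2)) ht
    have h' := norm_le_norm_add_norm_sub' (w t) (w 0)
    rw [sub_zero, Real.norm_of_nonneg ht.1] at h
    have : S * t ≤ |T| * S := by
      rw [mul_comm]; gcongr; exact ht.2.trans (le_abs_self T)
    linarith
  intro t ht
  have h4 := hincr y _ hy h3 t ht
  have h5 := hincr u _ hu h2 t ht
  rw [hy0] at h4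
  rw [hu0] at h5
  have h6 : ‖l⁻¹ • (u t - P (u t))‖ ≤ ‖y t‖ + ‖y t - l⁻¹ • (u t - P (u t))‖ := by
    have := norm_sub_le (y t) (y t - l⁻¹ • (u t - P (u t)))
    simpa using this
  have h7 := h2 t ht
  have h8 := h3 t ht
  have := norm_nonneg x
  have := norm_nonneg v
  refine ⟨by linarith, by linarith, by linarith, by linarith, by linarith⟩

/-- Comparison of two regularized systems. -/
theorem norm_sq_sub_le_of_yosida {K : Set E} {P : E → E} (hPK : ∀ x, P x ∈ K)
    (hP : ∀ x, ∀ z ∈ K, ⟪x - P x, z - P x⟫ ≤ 0) {G : E → E} {L : ℝ≥0}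
    (hG : LipschitzWith L G) {l m b T : ℝ} (hl : 0 < l) (hm : 0 < m) {u y w z : ℝ → E}
    (hu : ∀ t, 0 ≤ t → HasDerivAt u (y t - l⁻¹ • (u t - P (u t))) t)
    (hy : ∀ t, 0 ≤ t → HasDerivAt y (G (u t)) t)
    (hw : ∀ t, 0 ≤ t → HasDerivAt w (z t - m⁻¹ • (w t - P (w t))) t)
    (hz : ∀ t, 0 ≤ t → HasDerivAt z (G (w t)) t) (h0 : u 0 = w 0) (h0' : y 0 = z 0)
    (hub : ∀ t ∈ Icc 0 T, ‖l⁻¹ • (u t - P (u t))‖ ≤ b)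
    (hwb : ∀ t ∈ Icc 0 T, ‖m⁻¹ • (w t - P (w t))‖ ≤ b) (hT : 0 ≤ T) :
    ‖u T - w T‖ ^ 2 + ‖y T - z T‖ ^ 2 ≤
      Real.exp ((1 + L) * T) * (2 * (l + m) * b ^ 2 * T) := by
  have hd : ∀ s ∈ Icc 0 T, HasDerivAt (fun s => ‖u s - w s‖ ^ 2 + ‖y s - z s‖ ^ 2)
      (2 * ⟪u s - w s, (y s - l⁻¹ • (u s - P (u s))) - (z s - m⁻¹ • (w s - P (w s)))⟫ +
        2 * ⟪y s - z s, G (u s) - G (w s)⟫) s := fun s hs =>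
    ((hu s hs.1).sub (hw s hs.1)).norm_sq.add ((hy s hs.1).sub (hz s hs.1)).norm_sq
  have := le_exp_mul_of_hasDerivAt_le (c := 1 + L) (e := 2 * (l + m) * b ^ 2) (by positivity)
    (by positivity) hT hd ?_
  · simpa [h0, h0'] using this
  · intro s hs
    have h1 := inner_resolvent_sub_le hPK hP hl hm (hub s hs) (hwb s hs)
    have h2 : ⟪u s - w s, y s - z s⟫ ≤ ‖u s - w s‖ * ‖y s - z s‖ := real_inner_le_norm _ _
    have h3 : ⟪y s - z s, G (u s) - G (w s)⟫ ≤ ‖y s - z s‖ * (L * ‖u s - w s‖) :=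
      (real_inner_le_norm _ _).trans (by gcongr; exact hG.norm_sub_le _ _)
    have h4 : ⟪u s - w s, (y s - l⁻¹ • (u s - P (u s))) - (z s - m⁻¹ • (w s - P (w s)))⟫ =
        ⟪u s - w s, y s - z s⟫ -
        ⟪l⁻¹ • (u s - P (u s)) - m⁻¹ • (w s - P (w s)), u s - w s⟫ := by
      rw [real_inner_comm (u s - w s) (l⁻¹ • (u s - P (u s)) - m⁻¹ • (w s - P (w s))),
        ← inner_sub_right]
      congr 1; abel
    rw [h4]
    have h5 : (0:ℝ) ≤ L := L.2
    nlinarith [mul_nonneg h5 (sq_nonneg (‖u s - w s‖ - ‖y s - z s‖)),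
      sq_nonneg (‖u s - w s‖ - ‖y s - z s‖)]

end Evolution

section Limit

variable {E : Type*} [NormedAddCommGroup E] [InnerProductSpace ℝ E]

/-- The integrated evolution variational inequality for the regularized system. -/
theorem evi_of_yosida {K : Set E} {P : E → E} (hPK : ∀ x, P x ∈ K)
    (hP : ∀ x, ∀ z ∈ K, ⟪x - P x, z - P x⟫ ≤ 0) {l : ℝ} (hl : 0 < l) {u y : ℝ → E}
    (hu : ∀ t, 0 ≤ t → HasDerivAt u (y t - l⁻¹ • (u t - P (u t))) t)
    (hy : ContinuousOn y (Ici 0)) {Z : E} (hZ : Z ∈ K) {s t : ℝ} (hs : 0 ≤ s) (hst : s ≤ t) :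
    ‖u t - Z‖ ^ 2 - ‖u s - Z‖ ^ 2 ≤ 2 * ∫ r in s..t, ⟪y r, u r - Z⟫ := by
  have hPlip : LipschitzWith 1 P := LipschitzWith.of_dist_le_mul fun a b => by
    simpa [dist_eq_norm] using norm_sub_le_of_isProj hPK hP a b
  have huc : ContinuousOn u (Icc s t) := fun r hr =>
    (hu r (hs.trans hr.1)).continuousAt.continuousWithinAt
  have hyc : ContinuousOn y (Icc s t) := hy.mono fun r hr => hs.trans hr.1
  have hd : ∀ r ∈ Icc s t, HasDerivAt (fun r => ‖u r - Z‖ ^ 2)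
      (2 * ⟪u r - Z, y r - l⁻¹ • (u r - P (u r))⟫) r := fun r hr =>
    ((hu r (hs.trans hr.1)).sub_const Z).norm_sq
  have hPu : ContinuousOn (fun r => P (u r)) (Icc s t) := hPlip.continuous.comp_continuousOn huc
  have hc1 : ContinuousOn (fun r => 2 * ⟪u r - Z, y r - l⁻¹ • (u r - P (u r))⟫) (Icc s t) :=
    continuousOn_const.mul (ContinuousOn.inner (𝕜 := ℝ) (huc.sub continuousOn_const)
      (hyc.sub ((huc.sub hPu).const_smul _)))
  have hc2 : ContinuousOn (fun r => 2 * ⟪y r, u r - Z⟫) (Icc s t) :=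
    continuousOn_const.mul (ContinuousOn.inner (𝕜 := ℝ) hyc (huc.sub continuousOn_const))
  rw [← uIcc_of_le hst] at hd hc1 hc2
  rw [← intervalIntegral.integral_eq_sub_of_hasDerivAt hd hc1.intervalIntegrable,
    ← intervalIntegral.integral_const_mul]
  refine intervalIntegral.integral_mono_on hst hc1.intervalIntegrable
    hc2.intervalIntegrable ?_
  intro r _
  have h1 := hP (u r) Z hZ
  have h2 : 0 ≤ ⟪l⁻¹ • (u r - P (u r)), u r - Z⟫ := by
    rw [inner_smul_left]
    refine mul_nonneg (by simp [hl.le]) ?_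
    have h3 : u r - Z = (u r - P (u r)) - (Z - P (u r)) := by abel
    rw [h3, inner_sub_right, real_inner_self_eq_norm_sq]
    nlinarith [sq_nonneg ‖u r - P (u r)‖]
  rw [real_inner_comm, inner_sub_left]
  linarith

/-- One-sided differentiation of the evolution variational inequality. -/
theorem inner_le_zero_of_evi {u y : ℝ → E} {Z V : E} {t : ℝ}
    (hu : ContinuousOn u (Ici t)) (hy : ContinuousOn y (Ici t))
    (hV : HasDerivWithinAt u V (Ici t) t)
    (h : ∀ s, t ≤ s → ‖u s - Z‖ ^ 2 - ‖u t - Z‖ ^ 2 ≤ 2 * ∫ r in t..s, ⟪y r, u r - Z⟫) :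
    ⟪y t - V, Z - u t⟫ ≤ 0 := by
  have hc : ContinuousOn (fun r => ⟪y r, u r - Z⟫) (Ici t) := by fun_prop
  have h1 : HasDerivWithinAt (fun s => ∫ r in t..s, ⟪y r, u r - Z⟫) ⟪y t, u t - Z⟫ (Ici t) t :=
    intervalIntegral.integral_hasDerivWithinAt_right (t := Ioi t) (by simp)
      ⟨Ioi t, self_mem_nhdsWithin,
        (hc.mono Ioi_subset_Ici_self).aestronglyMeasurable measurableSet_Ioi⟩
      ((hc t self_mem_Ici).mono Ioi_subset_Ici_self)
  have h2 := (hV.sub_const Z).norm_sq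
  have h3 := (h1.const_mul 2).sub h2
  have h4 : 0 ≤ 2 * ⟪y t, u t - Z⟫ - 2 * ⟪u t - Z, V⟫ := by
    rw [← hasDerivWithinAt_Ioi_iff_Ici,
      hasDerivWithinAt_iff_tendsto_slope' self_notMem_Ioi] at h3
    refine ge_of_tendsto h3 ?_
    filter_upwards [self_mem_nhdsWithin] with s hs
    rw [slope_def_field]
    have := h s (le_of_lt hs)
    refine div_nonneg ?_ (sub_nonneg.2 (le_of_lt hs))
    simp
    linarith
  rw [← neg_sub (u t) Z, inner_neg_right, inner_sub_left]
  rw [real_inner_comm V] at h4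
  linarith

theorem exists_evi_solution [CompleteSpace E] {K : Set E} {P : E → E}
    (hPK : ∀ x, P x ∈ K) (hP : ∀ x, ∀ z ∈ K, ⟪x - P x, z - P x⟫ ≤ 0) {G : E → E} {L : ℝ≥0}
    (hG : LipschitzWith L G) {x : E} (hx : x ∈ K) (v : E) :
    ∃ u : ℝ → E, u 0 = x ∧ (∀ t, 0 ≤ t → u t ∈ K) ∧
      (∀ T : ℝ, ∃ C : ℝ≥0, LipschitzOnWith C u (Icc 0 T)) ∧
      ∀ Z ∈ K, ∀ s t, 0 ≤ s → s ≤ t → ‖u t - Z‖ ^ 2 - ‖u s - Z‖ ^ 2 ≤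
        2 * ∫ r in s..t, ⟪v + ∫ q in (0:ℝ)..r, G (u q), u r - Z⟫ := by
  set l : ℕ → ℝ := fun n => 1 / ((n : ℝ) + 1) with hl_def
  have hl : ∀ n, 0 < l n := fun n => by positivity
  have hl0 : Tendsto l atTop (𝓝 0) := tendsto_one_div_add_atTop_nhds_zero_nat
  have hlanti : Antitone l := fun a b hab => one_div_le_one_div_of_le (by positivity)
    (by simpa using hab)
  choose U Y hU0 hY0 hU hY using fun n => exists_yosida hPK hP hG _ x v
  choose b hb0 hb using fun T => exists_bound_of_yosida hPK hP hG hx v T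
  have hbd := fun T n t ht => hb T (l n) (hl n) (U n) (Y n) (hU0 n) (hY0 n) (hU n) (hY n) t ht
  have hcmp : ∀ t, 0 ≤ t → ∀ N n m, N ≤ n → N ≤ m → ‖U n t - U m t‖ ^ 2 + ‖Y n t - Y m t‖ ^ 2 ≤
      Real.exp ((1 + L) * t) * (2 * (l N + l N) * b t ^ 2 * t) := by
    intro t ht N n m hn hm
    refine (norm_sq_sub_le_of_yosida hPK hP hG (hl n) (hl m) (hU n) (hY n) (hU m) (hY m)
      (by rw [hU0, hU0]) (by rw [hY0, hY0]) (fun s hs => (hbd t n s hs).2.2.2.1)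
      (fun s hs => (hbd t m s hs).2.2.2.1) ht).trans ?_
    gcongr
    exacts [hlanti hn, hlanti hm]
  have hr0 : ∀ t, Tendsto (fun N => √(Real.exp ((1 + L) * t) * (2 * (l N + l N) * b t ^ 2 * t)))
      atTop (𝓝 0) := by
    intro t
    have : Tendsto (fun N => √(Real.exp ((1 + L) * t) * (2 * (l N + l N) * b t ^ 2 * t)))
      atTop (𝓝 √(Real.exp ((1 + L) * t) * (2 * (0 + 0) * b t ^ 2 * t))) :=
      (((((hl0.add hl0).const_mul 2).mul_const _).mul_const _).const_mul _).sqrt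
    simpa using this
  have hUc : ∀ t, 0 ≤ t → ∃ a, Tendsto (fun n => U n t) atTop (𝓝 a) := fun t ht =>
    cauchySeq_tendsto_of_complete <| cauchySeq_of_le_tendsto_0 _ (fun n m N hn hm => by
      rw [dist_eq_norm]
      exact Real.le_sqrt_of_sq_le (by nlinarith [hcmp t ht N n m hn hm, sq_nonneg ‖Y n t - Y m t‖]))
      (hr0 t)
  have hYc : ∀ t, 0 ≤ t → ∃ a, Tendsto (fun n => Y n t) atTop (𝓝 a) := fun t ht =>
    cauchySeq_tendsto_of_complete <| cauchySeq_of_le_tendsto_0 _ (fun n m N hn hm => by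
      rw [dist_eq_norm]
      exact Real.le_sqrt_of_sq_le (by nlinarith [hcmp t ht N n m hn hm, sq_nonneg ‖U n t - U m t‖]))
      (hr0 t)
  choose! u hu using hUc
  choose! y hy using hYc
  have hPlip : LipschitzWith 1 P := LipschitzWith.of_dist_le_mul fun a b => by
    simpa [dist_eq_norm] using norm_sub_le_of_isProj hPK hP a b
  have hUcont : ∀ n, ContinuousOn (U n) (Ici 0) := fun n t ht =>
    (hU n t ht).continuousAt.continuousWithinAt
  have hYcont : ∀ n, ContinuousOn (Y n) (Ici 0) := fun n t ht =>
    (hY n t ht).continuousAt.continuousWithinAt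
  have hyu : ∀ t, 0 ≤ t → y t = v + ∫ q in (0:ℝ)..t, G (u q) := by
    intro t ht
    have hsub : uIcc 0 t ⊆ Ici 0 := by rw [uIcc_of_le ht]; exact Icc_subset_Ici_self
    have hc : ∀ n, ContinuousOn (fun q => G (U n q)) (uIcc 0 t) := fun n =>
      hG.continuous.comp_continuousOn ((hUcont n).mono hsub)
    have h1 : ∀ n, Y n t = v + ∫ q in (0:ℝ)..t, G (U n q) := by
      intro n
      rw [intervalIntegral.integral_eq_sub_of_hasDerivAt (fun q hq => hY n q (hsub hq))
        (hc n).intervalIntegrable, hY0]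
      abel
    refine tendsto_nhds_unique (hy t ht) ?_
    simp_rw [h1]
    refine Tendsto.const_add v ?_
    refine intervalIntegral.tendsto_integral_filter_of_dominated_convergence (fun _ => b t) ?_ ?_
      (by simp) ?_
    · exact Eventually.of_forall fun n => ((hc n).mono uIoc_subset_uIcc).aestronglyMeasurable
        measurableSet_uIoc
    · refine Eventually.of_forall fun n => Eventually.of_forall fun q hq => ?_
      rw [uIoc_of_le ht] at hq
      exact (hbd t n q ⟨hq.1.le, hq.2⟩).2.1
    · refine Eventually.of_forall fun q hq => ?_
      rw [uIoc_of_le ht] at hq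
      exact (hG.continuous.tendsto _).comp (hu q hq.1.le)
  refine ⟨u, ?_, ?_, ?_, ?_⟩
  · exact tendsto_nhds_unique (hu 0 le_rfl) (by simp [hU0])
  · intro t ht
    have h1 : Tendsto (fun n => U n t - P (U n t)) atTop (𝓝 (u t - P (u t))) :=
      (hu t ht).sub ((hPlip.continuous.tendsto _).comp (hu t ht))
    have h2 : Tendsto (fun n => U n t - P (U n t)) atTop (𝓝 0) := by
      refine squeeze_zero_norm (a := fun n => l n * b t) (fun n => ?_) (by simpa using hl0.mul_const (b t))
      have := (hbd t n t ⟨ht, le_rfl⟩).2.2.2.1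
      rw [norm_smul, norm_inv, Real.norm_of_nonneg (hl n).le, inv_mul_le_iff₀ (hl n)] at this
      exact this
    have h3 := tendsto_nhds_unique h1 h2
    rw [sub_eq_zero.1 h3]
    exact hPK _
  · intro T
    refine ⟨⟨b T, hb0 T⟩, LipschitzOnWith.of_dist_le_mul fun s hs t ht => ?_⟩
    have h1 : ∀ n, dist (U n s) (U n t) ≤ b T * dist s t := fun n => by
      rw [dist_eq_norm, dist_eq_norm]
      exact (convex_Icc (0:ℝ) T).norm_image_sub_le_of_norm_hasDerivWithin_le
        (fun r hr => (hU n r hr.1).hasDerivWithinAt) (fun r hr => (hbd T n r hr).1) ht hs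
    exact le_of_tendsto ((hu s hs.1).dist (hu t ht.1)) (Eventually.of_forall h1)
  · intro Z hZ s t hs hst
    have ht := hs.trans hst
    have hsub : uIoc s t ⊆ Ici 0 := by
      rw [uIoc_of_le hst]; exact fun r hr => hs.trans hr.1.le
    have h1 : ∀ n, ‖U n t - Z‖ ^ 2 - ‖U n s - Z‖ ^ 2 ≤ 2 * ∫ r in s..t, ⟪Y n r, U n r - Z⟫ :=
      fun n => evi_of_yosida hPK hP (hl n) (hU n) (hYcont n) hZ hs hst
    have h2 : Tendsto (fun n => ∫ r in s..t, ⟪Y n r, U n r - Z⟫) atTop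
        (𝓝 (∫ r in s..t, ⟪y r, u r - Z⟫)) := by
      refine intervalIntegral.tendsto_integral_filter_of_dominated_convergence
        (fun _ => b t * (b t + ‖Z‖)) ?_ ?_ (by simp) ?_
      · exact Eventually.of_forall fun n => (ContinuousOn.inner (𝕜 := ℝ) ((hYcont n).mono hsub)
          (((hUcont n).mono hsub).sub continuousOn_const)).aestronglyMeasurable measurableSet_uIoc
      · refine Eventually.of_forall fun n => Eventually.of_forall fun q hq => ?_
        rw [uIoc_of_le hst] at hq
        have hB := hbd t n q ⟨hs.trans hq.1.le, hq.2⟩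
        refine (norm_inner_le_norm _ _).trans (mul_le_mul hB.2.2.1 ?_ (norm_nonneg _) (hb0 t))
        exact (norm_sub_le _ _).trans (by gcongr; exact hB.2.2.2.2)
      · refine Eventually.of_forall fun q hq => ?_
        have := hsub hq
        exact (hy q this).inner ((hu q this).sub_const Z)
    have h3 : ∫ r in s..t, ⟪v + ∫ q in (0:ℝ)..r, G (u q), u r - Z⟫ =
        ∫ r in s..t, ⟪y r, u r - Z⟫ := by
      refine intervalIntegral.integral_congr fun r hr => ?_
      rw [uIcc_of_le hst] at hr
      simp only [hyu r (hs.trans hr.1)]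
    rw [h3]
    exact le_of_tendsto_of_tendsto ((((hu t ht).sub_const Z).norm.pow 2).sub
      (((hu s hs).sub_const Z).norm.pow 2)) (h2.const_mul 2) (Eventually.of_forall h1)

end Limit

section IntegralIoc

variable {E : Type*} [NormedAddCommGroup E]

theorem ContinuousOn.intervalIntegrable_of_Ici {f : ℝ → E} (hf : ContinuousOn f (Ici 0))
    {s t : ℝ} (hs : 0 ≤ s) (ht : 0 ≤ t) : IntervalIntegrable f volume s t :=
  (hf.mono fun _ hr => (le_min hs ht).trans hr.1).intervalIntegrable

theorem continuousOn_Ici_of_forall_lipschitzOnWith {u : ℝ → E}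
    (h : ∀ T : ℝ, ∃ C : ℝ≥0, LipschitzOnWith C u (Icc 0 T)) : ContinuousOn u (Ici 0) := by
  intro t ht
  obtain ⟨C, hC⟩ := h (t + 1)
  have ht1 : t < t + 1 := lt_add_one t
  refine (hC.continuousOn t ⟨ht, ht1.le⟩).mono_of_mem_nhdsWithin ?_
  rw [← Ici_inter_Iic]
  exact inter_mem_nhdsWithin _ (Iic_mem_nhds ht1)

variable [NormedSpace ℝ E]

theorem ContinuousOn.hasDerivAt_integral_Ioc [CompleteSpace E] {f : ℝ → E}
    (hf : ContinuousOn f (Ici 0)) {t : ℝ} (ht : 0 < t) :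
    HasDerivAt (fun r => ∫ s in Ioc (0:ℝ) r, f s) (f t) t := by
  have h : HasDerivAt (fun r => ∫ s in (0:ℝ)..r, f s) (f t) t :=
    intervalIntegral.integral_hasDerivAt_right (hf.intervalIntegrable_of_Ici le_rfl ht.le)
      ⟨Ioi 0, Ioi_mem_nhds ht,
        (hf.mono Ioi_subset_Ici_self).aestronglyMeasurable measurableSet_Ioi⟩
      (hf.continuousAt (Ici_mem_nhds ht))
  refine h.congr_of_eventuallyEq ?_
  filter_upwards [Ioi_mem_nhds ht] with r hr
  exact (intervalIntegral.integral_of_le (le_of_lt hr)).symm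

theorem ContinuousOn.integral_Ioc_sub_integral_Ioc {f : ℝ → E} (hf : ContinuousOn f (Ici 0))
    {s t : ℝ} (hs : 0 ≤ s) (hst : s ≤ t) :
    (∫ r in Ioc (0:ℝ) t, f r) - ∫ r in Ioc (0:ℝ) s, f r = ∫ r in Ioc s t, f r := by
  rw [← intervalIntegral.integral_of_le (hs.trans hst), ← intervalIntegral.integral_of_le hs,
    ← intervalIntegral.integral_of_le hst]
  exact intervalIntegral.integral_interval_sub_left
    (hf.intervalIntegrable_of_Ici le_rfl (hs.trans hst)) (hf.intervalIntegrable_of_Ici le_rfl hs)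

theorem ContinuousOn.exists_lipschitzOnWith_integral_Ioc {f : ℝ → E}
    (hf : ContinuousOn f (Ici 0)) (T : ℝ) :
    ∃ C, LipschitzOnWith C (fun r => ∫ s in Ioc (0:ℝ) r, f s) (Icc 0 T) := by
  obtain ⟨M, hM⟩ := (isCompact_Icc (a := (0:ℝ)) (b := T)).exists_bound_of_continuousOn
    (hf.mono Icc_subset_Ici_self)
  refine ⟨⟨|M|, abs_nonneg M⟩, LipschitzOnWith.of_dist_le_mul fun s hs t ht => ?_⟩
  wlog hst : t ≤ s generalizing s t
  · rw [dist_comm, dist_comm s]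
    exact this t ht s hs (le_of_not_ge hst)
  rw [dist_eq_norm, hf.integral_Ioc_sub_integral_Ioc ht.1 hst,
    ← intervalIntegral.integral_of_le hst, dist_eq_norm]
  refine intervalIntegral.norm_integral_le_of_norm_le_const fun r hr => ?_
  rw [uIoc_of_le hst] at hr
  exact (hM r ⟨ht.1.trans hr.1.le, hr.2.trans hs.2⟩).trans (le_abs_self M)

theorem ContinuousOn.continuousOn_integral_Ioc {f : ℝ → E} (hf : ContinuousOn f (Ici 0)) :
    ContinuousOn (fun r => ∫ s in Ioc (0:ℝ) r, f s) (Ici 0) :=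
  continuousOn_Ici_of_forall_lipschitzOnWith hf.exists_lipschitzOnWith_integral_Ioc

end IntegralIoc

section Lagrangian

variable {E : Type*} [NormedAddCommGroup E] [InnerProductSpace ℝ E]

/-- A Lagrangian solution for an arbitrary constraint set `K` of a Hilbert space. -/
def IsLagrangian (K : Set E) (F : E → E) (x v : E) (u : ℝ → E) : Prop :=
  (∀ t : ℝ, 0 ≤ t → u t ∈ K) ∧ u 0 = x ∧
  (∀ T : ℝ, ∃ L : ℝ≥0, LipschitzOnWith L u (Set.Icc 0 T)) ∧
  (∀ᵐ t ∂(volume.restrict (Set.Ioi (0:ℝ))),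
    ∃ V : E, HasDerivAt u V t ∧
      ∀ Z ∈ K, ⟪(v + ∫ s in Set.Ioc (0:ℝ) t, F (u s)) - V, Z - u t⟫ ≤ 0)

namespace IsLagrangian

variable {K : Set E} {F : E → E} {x v : E} {u : ℝ → E}

theorem continuousOn (h : IsLagrangian K F x v u) : ContinuousOn u (Ici 0) :=
  continuousOn_Ici_of_forall_lipschitzOnWith h.2.2.1

theorem continuousOn_comp (h : IsLagrangian K F x v u) {L : ℝ≥0} (hF : LipschitzOnWith L F K) :
    ContinuousOn (fun t => F (u t)) (Ici 0) :=
  hF.continuousOn.comp h.continuousOn fun t ht => h.1 t ht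

theorem evi [CompleteSpace E] (h : IsLagrangian K F x v u) {L : ℝ≥0}
    (hF : LipschitzOnWith L F K) {Z : E} (hZ : Z ∈ K) {s t : ℝ} (hs : 0 ≤ s) (hst : s ≤ t) :
    ‖u t - Z‖ ^ 2 - ‖u s - Z‖ ^ 2 ≤
      2 * ∫ r in s..t, ⟪v + ∫ q in Ioc (0:ℝ) r, F (u q), u r - Z⟫ := by
  have hFc := h.continuousOn_comp hF
  set f : ℝ → ℝ := fun r => ⟪v + ∫ q in Ioc (0:ℝ) r, F (u q), u r - Z⟫ with hf_def
  have hf : ContinuousOn f (Ici 0) := ContinuousOn.inner (𝕜 := ℝ)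
    (continuousOn_const.add hFc.continuousOn_integral_Ioc)
    (h.continuousOn.sub continuousOn_const)
  obtain ⟨C, hC⟩ := h.2.2.1 t
  have hsub : uIcc s t ⊆ Icc 0 t := by
    rw [uIcc_of_le hst]; exact Icc_subset_Icc_left hs
  have h1 : AbsolutelyContinuousOnInterval (fun r => ‖u r - Z‖) s t := by
    refine LipschitzOnWith.absolutelyContinuousOnInterval (K := C)
      (LipschitzOnWith.of_dist_le_mul fun a ha b hb => ?_)
    refine (dist_norm_norm_le _ _).trans ?_
    rw [sub_sub_sub_cancel_right, ← dist_eq_norm]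
    exact hC.dist_le_mul a (hsub ha) b (hsub hb)
  obtain ⟨C', hC'⟩ := hf.exists_lipschitzOnWith_integral_Ioc t
  have h2 : AbsolutelyContinuousOnInterval (fun r => ∫ q in Ioc (0:ℝ) r, f q) s t :=
    (hC'.mono hsub).absolutelyContinuousOnInterval
  have h3 := ((h1.mul h1).sub (h2.const_mul 2)).le_of_ae_hasDerivAt_nonpos hst ?_
  · simp only [Pi.sub_apply, Pi.mul_apply] at h3
    have h4 := hf.integral_Ioc_sub_integral_Ioc hs hst
    rw [intervalIntegral.integral_of_le hst, ← h4]
    linarith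
  · have h4 := (ae_restrict_iff' measurableSet_Ioi).1 h.2.2.2
    filter_upwards [h4] with r hr hrm
    have hr0 : 0 < r := hs.trans_lt hrm.1
    obtain ⟨V, hV, hVn⟩ := hr hr0
    have h5 : HasDerivAt (fun r => ‖u r - Z‖ * ‖u r - Z‖) (2 * ⟪u r - Z, V⟫) r := by
      simpa only [sq] using (hV.sub_const Z).norm_sq
    refine ⟨_, ?_, h5.sub ((hf.hasDerivAt_integral_Ioc hr0).const_mul 2)⟩
    have h6 := hVn Z hZ
    simp only [hf_def]
    rw [← neg_sub (u r) Z, inner_neg_right, inner_sub_left] at h6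
    rw [real_inner_comm V]
    linarith

theorem inner_right_deriv_le [CompleteSpace E] (h : IsLagrangian K F x v u) {L : ℝ≥0}
    (hF : LipschitzOnWith L F K) {t : ℝ} (ht : 0 ≤ t) {V : E}
    (hV : HasDerivWithinAt u V (Ici t) t) {Z : E} (hZ : Z ∈ K) :
    ⟪(v + ∫ q in Ioc (0:ℝ) t, F (u q)) - V, Z - u t⟫ ≤ 0 := by
  have hsub : Ici t ⊆ Ici 0 := Ici_subset_Ici.2 ht
  exact inner_le_zero_of_evi (y := fun t => v + ∫ q in Ioc (0:ℝ) t, F (u q))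
    (h.continuousOn.mono hsub)
    ((continuousOn_const.add (h.continuousOn_comp hF).continuousOn_integral_Ioc).mono hsub) hV
    fun s hs => h.evi hF hZ ht hs

/-- Existence of Lagrangian solutions. -/
theorem exists_of_isProj [CompleteSpace E] [SecondCountableTopology E] {P : E → E}
    (hPK : ∀ x, P x ∈ K) (hP : ∀ x, ∀ z ∈ K, ⟪x - P x, z - P x⟫ ≤ 0) {L : ℝ≥0}
    (hF : LipschitzOnWith L F K) (hx : x ∈ K) (v : E) : ∃ u, IsLagrangian K F x v u := by
  have hPlip : LipschitzWith 1 P := LipschitzWith.of_dist_le_mul fun a b => by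
    simpa [dist_eq_norm] using norm_sub_le_of_isProj hPK hP a b
  have hG : LipschitzWith L (fun z => F (P z)) := by
    rw [← lipschitzOnWith_univ]
    rw [← mul_one L]
    exact hF.comp (lipschitzOnWith_univ.2 hPlip) (fun z _ => hPK z)
  have hPfix : ∀ z ∈ K, P z = z := fun z hz => by
    have h := hP z z hz
    rw [real_inner_self_eq_norm_sq] at h
    exact (sub_eq_zero.1 (norm_eq_zero.1
      (pow_eq_zero_iff two_ne_zero |>.1 (le_antisymm h (by positivity))))).symm
  obtain ⟨u, hu0, huK, huL, hevi⟩ := exists_evi_solution hPK hP hG hx v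
  have huc : ContinuousOn u (Ici 0) :=
    continuousOn_Ici_of_forall_lipschitzOnWith huL
  have hFc : ContinuousOn (fun t => F (P (u t))) (Ici 0) := hG.continuous.comp_continuousOn huc
  have hdiff : ∀ n : ℕ, ∀ᵐ t, t ∈ Ioo (0:ℝ) n → DifferentiableAt ℝ u t := by
    intro n
    obtain ⟨C, hC⟩ := huL n
    have hn : (0:ℝ) ≤ n := n.cast_nonneg
    have h1 : LipschitzWith (C * 1) (IccExtend hn (domRestrict (Icc (0:ℝ) n) u)) :=
      hC.to_restrict.comp (LipschitzWith.projIcc hn)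
    filter_upwards [h1.ae_differentiableAt_of_hilbert] with t ht hm
    refine ht.congr_of_eventuallyEq ?_
    filter_upwards [Ioo_mem_nhds hm.1 hm.2] with s hs
    rw [IccExtend_of_mem _ _ (Ioo_subset_Icc_self hs)]
    rfl
  refine ⟨u, huK, hu0, huL, ?_⟩
  rw [ae_restrict_iff' measurableSet_Ioi]
  filter_upwards [ae_all_iff.2 hdiff] with t ht ht0
  obtain ⟨n, hn⟩ := exists_nat_gt t
  have hd := (ht n ⟨ht0, hn⟩).hasDerivAt
  have ht0' : 0 ≤ t := le_of_lt ht0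
  refine ⟨_, hd, fun Z hZ => ?_⟩
  have hsub : Ici t ⊆ Ici 0 := Ici_subset_Ici.2 ht0'
  have h2 : (∫ s in Ioc (0:ℝ) t, F (u s)) = ∫ s in Ioc (0:ℝ) t, F (P (u s)) :=
    setIntegral_congr_fun measurableSet_Ioc fun s hs => by
      simp only [hPfix _ (huK s hs.1.le)]
  rw [h2]
  refine inner_le_zero_of_evi (y := fun t => v + ∫ q in Ioc (0:ℝ) t, F (P (u q)))
    (huc.mono hsub) ((continuousOn_const.add hFc.continuousOn_integral_Ioc).mono hsub)
    hd.hasDerivWithinAt fun s hs => (hevi Z hZ t s ht0' hs).trans_eq ?_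
  congr 1
  refine intervalIntegral.integral_congr fun r hr => ?_
  rw [uIcc_of_le hs] at hr
  rw [intervalIntegral.integral_of_le (ht0'.trans hr.1)]

/-- Uniqueness of Lagrangian solutions. -/
theorem unique [CompleteSpace E] {u' : ℝ → E} (h : IsLagrangian K F x v u)
    (h' : IsLagrangian K F x v u') {L : ℝ≥0} (hF : LipschitzOnWith L F K) {t : ℝ} (ht : 0 ≤ t) :
    u t = u' t := by
  have hFc := h.continuousOn_comp hF
  have hFc' := h'.continuousOn_comp hF
  obtain ⟨C1, hC1⟩ := h.2.2.1 t
  obtain ⟨C2, hC2⟩ := h'.2.2.1 t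
  obtain ⟨D1, hD1⟩ := hFc.exists_lipschitzOnWith_integral_Ioc t
  obtain ⟨D2, hD2⟩ := hFc'.exists_lipschitzOnWith_integral_Ioc t
  have hac : ∀ {C : ℝ≥0} {g : ℝ → E}, LipschitzOnWith C g (Icc 0 t) →
      AbsolutelyContinuousOnInterval (fun r => ‖g r‖) 0 t := fun {C g} hg => by
    refine LipschitzOnWith.absolutelyContinuousOnInterval (K := C) ?_
    rw [uIcc_of_le ht]
    exact LipschitzOnWith.of_dist_le_mul fun a ha b hb =>
      (dist_norm_norm_le _ _).trans (by rw [← dist_eq_norm]; exact hg.dist_le_mul a ha b hb)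
  have h1 := hac (hC1.sub hC2)
  have h2 := hac (hD1.sub hD2)
  have h3 := ((h1.mul h1).add (h2.mul h2)).le_exp_mul_of_ae_hasDerivAt_le (c := 1 + L) ht ?_
  · simp only [Pi.add_apply, Pi.mul_apply, h.2.1, h'.2.1] at h3
    simp only [Ioc_self, Measure.restrict_empty, integral_zero_measure, sub_self, norm_zero,
      mul_zero, add_zero] at h3
    have h4 : ‖u t - u' t‖ * ‖u t - u' t‖ ≤ 0 := by
      refine le_trans (le_add_of_nonneg_right (mul_self_nonneg _)) h3
    exact sub_eq_zero.1 (norm_eq_zero.1 (mul_self_eq_zero.1 (le_antisymm h4 (mul_self_nonneg _))))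
  · have h4 := (ae_restrict_iff' measurableSet_Ioi).1 h.2.2.2
    have h4' := (ae_restrict_iff' measurableSet_Ioi).1 h'.2.2.2
    filter_upwards [h4, h4'] with r hr hr' hrm
    obtain ⟨V, hV, hVn⟩ := hr hrm.1
    obtain ⟨V', hV', hVn'⟩ := hr' hrm.1
    have d1 := (hV.sub hV').norm_sq
    have d2 := ((hFc.hasDerivAt_integral_Ioc hrm.1).sub
      (hFc'.hasDerivAt_integral_Ioc hrm.1)).norm_sq
    refine ⟨_, ?_, (d1.add d2).congr_of_eventuallyEq (Eventually.of_forall fun q => ?_)⟩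
    · have e1 := hVn _ (h'.1 r hrm.1.le)
      have e2 := hVn' _ (h.1 r hrm.1.le)
      set I := ∫ s in Ioc (0:ℝ) r, F (u s)
      set I' := ∫ s in Ioc (0:ℝ) r, F (u' s)
      simp only [Pi.add_apply, Pi.mul_apply, Pi.sub_apply]
      have e3 : ⟪u r - u' r, V - V'⟫ ≤ ⟪u r - u' r, I - I'⟫ := by
        simp only [inner_sub_left, inner_sub_right, inner_add_left, real_inner_comm] at *
        linarith
      have e4 : ⟪u r - u' r, I - I'⟫ ≤ ‖u r - u' r‖ * ‖I - I'‖ := real_inner_le_norm _ _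
      have e5 : ⟪I - I', F (u r) - F (u' r)⟫ ≤ ‖I - I'‖ * (L * ‖u r - u' r‖) :=
        (real_inner_le_norm _ _).trans (by
          gcongr
          have := hF.dist_le_mul _ (h.1 r hrm.1.le) _ (h'.1 r hrm.1.le)
          rwa [dist_eq_norm, dist_eq_norm] at this)
      have h5 : (0:ℝ) ≤ L := L.2
      nlinarith [mul_nonneg h5 (sq_nonneg (‖u r - u' r‖ - ‖I - I'‖)),
        sq_nonneg (‖u r - u' r‖ - ‖I - I'‖)]
    · simp [sq]

theorem shift (h : IsLagrangian K F x v u) {L : ℝ≥0} (hF : LipschitzOnWith L F K)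
    {τ : ℝ} (hτ : 0 ≤ τ) :
    IsLagrangian K F (u τ) (v + ∫ s in Ioc (0:ℝ) τ, F (u s)) (fun t => u (t + τ)) := by
  have hFc := h.continuousOn_comp hF
  refine ⟨fun t ht => h.1 _ (by linarith), by simp, fun T => ?_, ?_⟩
  · obtain ⟨C, hC⟩ := h.2.2.1 (T + τ)
    refine ⟨C, LipschitzOnWith.of_dist_le_mul fun a ha b hb => ?_⟩
    simpa using hC.dist_le_mul (a + τ) ⟨by linarith [ha.1], by linarith [ha.2]⟩ (b + τ)
      ⟨by linarith [hb.1], by linarith [hb.2]⟩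
  · have h1 := (ae_restrict_iff' measurableSet_Ioi).1 h.2.2.2
    rw [ae_restrict_iff' measurableSet_Ioi]
    have h2 := (measurePreserving_add_right volume τ).quasiMeasurePreserving.ae h1
    filter_upwards [h2] with t ht ht0
    have ht0' : (0:ℝ) < t := ht0
    obtain ⟨V, hV, hVn⟩ := ht (by simp only [mem_Ioi]; linarith)
    refine ⟨V, hV.comp_add_const t τ, fun Z hZ => ?_⟩
    have h3 : ∫ s in Ioc (0:ℝ) t, F (u (s + τ)) = ∫ s in Ioc τ (t + τ), F (u s) := by
      rw [← intervalIntegral.integral_of_le ht0'.le,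
        ← intervalIntegral.integral_of_le (by linarith),
        intervalIntegral.integral_comp_add_right (fun s => F (u s)), zero_add]
    rw [h3, ← hFc.integral_Ioc_sub_integral_Ioc hτ (by linarith), add_add_sub_cancel]
    exact hVn Z hZ

theorem add_normal {w : E} (h : IsLagrangian K F x v u)
    (hw : ∀ t, 0 ≤ t → ∀ Z ∈ K, ⟪w, Z - u t⟫ ≤ 0) : IsLagrangian K F x (v + w) u := by
  refine ⟨h.1, h.2.1, h.2.2.1, ?_⟩
  have h1 := (ae_restrict_iff' measurableSet_Ioi).1 h.2.2.2
  rw [ae_restrict_iff' measurableSet_Ioi]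
  filter_upwards [h1] with t ht ht0
  obtain ⟨V, hV, hVn⟩ := ht ht0
  refine ⟨V, hV, fun Z hZ => ?_⟩
  have h2 := hVn Z hZ
  have h3 := hw t (le_of_lt ht0) Z hZ
  rw [show v + w + (∫ s in Ioc (0:ℝ) t, F (u s)) - V =
    (v + (∫ s in Ioc (0:ℝ) t, F (u s)) - V) + w by abel, inner_add_left]
  linarith

end IsLagrangian

end Lagrangian

section Cone

instance : IsProbabilityMeasure mu := ⟨by simp [mu, Omg]⟩

theorem ae_mem_Omg : ∀ᵐ x ∂mu, x ∈ Omg := ae_restrict_mem measurableSet_Ioo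

theorem exists_mem_Ioo_of_ae {S : Set ℝ} (hS : ∀ᵐ x ∂mu, x ∈ S) {a b : ℝ} (hab : a < b)
    (ha : 0 ≤ a) (hb : b ≤ 1) : ∃ x ∈ S, x ∈ Ioo a b := by
  by_contra! h
  have h1 : mu (Ioo a b) = 0 := by
    refine measure_mono_null (fun x hx hxS => h x hxS hx) (mem_ae_iff.1 hS)
  rw [mu, Measure.restrict_apply measurableSet_Ioo,
    inter_eq_left.2 (show Ioo a b ⊆ Omg from Ioo_subset_Ioo ha hb), Real.volume_Ioo] at h1
  simp only [ENNReal.ofReal_eq_zero] at h1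
  linarith

/-- A function which is nondecreasing on a set of full measure belongs to the cone. -/
theorem mem_Kcone_of_ae {X : L2} {S : Set ℝ} (hS : ∀ᵐ x ∂mu, x ∈ S)
    (h : ∀ x ∈ S, ∀ y ∈ S, x ∈ Omg → y ∈ Omg → x ≤ y → X x ≤ X y) : X ∈ Kcone := by
  set A : ℝ → Set ℝ := fun x => {c | ∃ y ∈ S, y ∈ Omg ∧ y ≤ x ∧ X y = c} with hA
  have hbdd : ∀ x ∈ Omg, BddAbove (A x) := by
    intro x hx
    obtain ⟨z, hzS, hz⟩ := exists_mem_Ioo_of_ae hS hx.2 hx.1.le le_rfl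
    refine ⟨X z, ?_⟩
    rintro c ⟨y, hyS, hy, hyx, rfl⟩
    exact h y hyS z hzS hy ⟨hx.1.trans hz.1, hz.2⟩ (hyx.trans hz.1.le)
  have hne : ∀ x ∈ Omg, (A x).Nonempty := by
    intro x hx
    obtain ⟨z, hzS, hz⟩ := exists_mem_Ioo_of_ae hS hx.1 le_rfl hx.2.le
    exact ⟨_, z, hzS, ⟨hz.1, hz.2.trans hx.2⟩, hz.2.le, rfl⟩
  refine ⟨fun x => sSup (A x), fun x hx y hy hxy => ?_, ?_⟩
  · refine csSup_le_csSup (hbdd y hy) (hne x hx) ?_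
    rintro c ⟨z, hzS, hz, hzx, rfl⟩
    exact ⟨z, hzS, hz, hzx.trans hxy, rfl⟩
  · filter_upwards [hS, ae_mem_Omg] with x hxS hx
    refine le_antisymm (le_csSup (hbdd x hx) ⟨x, hxS, hx, le_rfl, rfl⟩) (csSup_le (hne x hx) ?_)
    rintro c ⟨y, hyS, hy, hyx, rfl⟩
    exact h y hyS x hxS hy hx hyx

theorem exists_subseq_tendsto_ae {u : ℕ → L2} {X : L2} (h : Tendsto u atTop (𝓝 X)) :
    ∃ ns : ℕ → ℕ, StrictMono ns ∧
      ∀ᵐ x ∂mu, Tendsto (fun i => u (ns i) x) atTop (𝓝 (X x)) :=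
  (tendstoInMeasure_of_tendsto_Lp h).exists_seq_tendsto_ae

theorem isClosed_Kcone : IsClosed Kcone := by
  refine isSeqClosed_iff_isClosed.1 fun u X hu hX => ?_
  obtain ⟨ns, -, hns⟩ := exists_subseq_tendsto_ae hX
  choose g hg hgu using hu
  have h1 : ∀ᵐ x ∂mu, ∀ n, u n x = g n x := ae_all_iff.2 hgu
  refine mem_Kcone_of_ae (S := {x | (∀ n, u n x = g n x) ∧
    Tendsto (fun i => u (ns i) x) atTop (𝓝 (X x))}) (h1.and hns) ?_
  intro x hx y hy hxO hyO hxy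
  refine le_of_tendsto_of_tendsto' hx.2 hy.2 fun i => ?_
  rw [hx.1, hy.1]
  exact hg _ hxO hyO hxy

theorem add_mem_Kcone {X Y : L2} (hX : X ∈ Kcone) (hY : Y ∈ Kcone) : X + Y ∈ Kcone := by
  obtain ⟨g, hg, hgX⟩ := hX
  obtain ⟨g', hg', hgY⟩ := hY
  refine ⟨g + g', hg.add hg', ?_⟩
  filter_upwards [Lp.coeFn_add X Y, hgX, hgY] with x h1 h2 h3
  rw [h1, Pi.add_apply, Pi.add_apply, h2, h3]

theorem smul_mem_Kcone {X : L2} (hX : X ∈ Kcone) {c : ℝ} (hc : 0 ≤ c) : c • X ∈ Kcone := by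
  obtain ⟨g, hg, hgX⟩ := hX
  refine ⟨fun x => c * g x, fun x hx y hy hxy => mul_le_mul_of_nonneg_left (hg hx hy hxy) hc, ?_⟩
  filter_upwards [Lp.coeFn_smul c X, hgX] with x h1 h2
  rw [h1, Pi.smul_apply, smul_eq_mul, h2]

theorem convex_Kcone : Convex ℝ Kcone := fun _ hX _ hY _ _ ha hb _ =>
  add_mem_Kcone (smul_mem_Kcone hX ha) (smul_mem_Kcone hY hb)

theorem zero_mem_Kcone : (0 : L2) ∈ Kcone :=
  ⟨fun _ => 0, monotoneOn_const, Lp.coeFn_zero _ _ _⟩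

theorem exists_projK : ∃ P : L2 → L2, (∀ x, P x ∈ Kcone) ∧
    ∀ x, ∀ z ∈ Kcone, ⟪x - P x, z - P x⟫ ≤ 0 := by
  choose P hPK hP using exists_norm_eq_iInf_of_complete_convex ⟨0, zero_mem_Kcone⟩
    isClosed_Kcone.isComplete convex_Kcone
  exact ⟨P, hPK, fun x => (norm_eq_iInf_iff_real_inner_le_zero convex_Kcone (hPK x)).1 (hP x)⟩

theorem mem_normalCone_iff {X W : L2} (hX : X ∈ Kcone) :
    W ∈ normalCone X ↔ ⟪W, X⟫ = 0 ∧ ∀ Z ∈ Kcone, ⟪W, Z⟫ ≤ 0 := by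
  constructor
  · intro h
    have h0 := h 0 zero_mem_Kcone
    have h2 := h ((2:ℝ) • X) (smul_mem_Kcone hX zero_le_two)
    rw [inner_sub_right, inner_zero_right] at h0
    rw [inner_sub_right, inner_smul_right] at h2
    have hWX : ⟪W, X⟫ = 0 := by linarith
    refine ⟨hWX, fun Z hZ => ?_⟩
    have := h Z hZ
    rw [inner_sub_right, hWX] at this
    linarith
  · rintro ⟨h1, h2⟩ Z hZ
    rw [inner_sub_right, h1, sub_zero]
    exact h2 Z hZ

theorem add_mem_normalCone {X W W' : L2} (h : W ∈ normalCone X) (h' : W' ∈ normalCone X) :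
    W + W' ∈ normalCone X := fun Z hZ => by
  rw [inner_add_left]
  exact add_nonpos (h Z hZ) (h' Z hZ)

theorem smul_mem_normalCone {X W : L2} (h : W ∈ normalCone X) {c : ℝ} (hc : 0 ≤ c) :
    c • W ∈ normalCone X := fun Z hZ => by
  rw [inner_smul_left]
  exact mul_nonpos_of_nonneg_of_nonpos (by simpa using hc) (h Z hZ)

theorem isClosed_normalCone (X : L2) : IsClosed (normalCone X) := by
  have : normalCone X = ⋂ Y ∈ Kcone, {W : L2 | ⟪W, Y - X⟫ ≤ 0} := by
    ext W; simp [normalCone]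
  rw [this]
  refine isClosed_biInter fun Y _ => isClosed_le ?_ continuous_const
  exact continuous_id.inner continuous_const

/-- A superlevel set of a nondecreasing function is a half-line, up to its endpoint. -/
theorem exists_superlevel_eq_Ioi {g : ℝ → ℝ} (hg : MonotoneOn g Omg) (c : ℝ) :
    ∃ p : ℝ, (∀ x ∈ Omg, c < g x → p ≤ x) ∧ (∀ x ∈ Omg, ¬ c < g x → x ≤ p) := by
  set S : Set ℝ := insert 1 {x | x ∈ Omg ∧ c < g x} with hS
  have hne : S.Nonempty := ⟨1, mem_insert _ _⟩
  have hbd : BddBelow S := by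
    refine ⟨0, ?_⟩
    rintro x (rfl | hx)
    exacts [zero_le_one, hx.1.1.le]
  refine ⟨sInf S, fun x hx hc => csInf_le hbd (Or.inr ⟨hx, hc⟩), fun x hx hc => ?_⟩
  refine le_csInf hne ?_
  rintro y (rfl | hy)
  · exact hx.2.le
  · by_contra! hyx
    exact hc (hy.2.trans_le (hg hy.1 hx hyx.le))

theorem superlevel_ae_eq_Ioi {X : L2} {g : ℝ → ℝ} (hgX : X =ᵐ[mu] g) {c p : ℝ}
    (h1 : ∀ x ∈ Omg, c < g x → p ≤ x) (h2 : ∀ x ∈ Omg, ¬ c < g x → x ≤ p) :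
    {x | c < X x} =ᵐ[mu] Ioi p := by
  have h3 : ∀ᵐ x ∂mu, x ≠ p := by
    refine ae_restrict_of_ae ?_
    simp [ae_iff]
  filter_upwards [hgX, ae_mem_Omg, h3] with x hx hxO hxp
  refine propext ⟨fun h => ?_, fun h => ?_⟩
  · have h' : c < g x := hx ▸ h
    exact lt_of_le_of_ne (h1 x hxO h') (Ne.symm hxp)
  · by_contra h'
    have : ¬ c < g x := fun h'' => h' (show c < X x from hx ▸ h'')
    exact absurd (h2 x hxO this) (not_le.2 h)

/-- The indicator function of `(p, ∞)` as an element of `L²`. -/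
def stepLp (p : ℝ) : L2 :=
  indicatorConstLp 2 (measurableSet_Ioi (a := p)) (measure_ne_top mu _) (1 : ℝ)

theorem inner_stepLp (p : ℝ) (W : L2) : ⟪W, stepLp p⟫ = ∫ x in Ioi p, W x ∂mu := by
  rw [real_inner_comm, stepLp, L2.inner_indicatorConstLp_one]

theorem stepLp_ae (p : ℝ) : stepLp p =ᵐ[mu] (Ioi p).indicator fun _ => (1:ℝ) :=
  indicatorConstLp_coeFn

theorem stepLp_mem_Kcone (p : ℝ) : stepLp p ∈ Kcone := by
  refine ⟨_, fun x _ y _ hxy => ?_, stepLp_ae p⟩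
  by_cases hx : x ∈ Ioi p
  · rw [indicator_of_mem hx, indicator_of_mem (show y ∈ Ioi p from lt_of_lt_of_le hx hxy)]
  · rw [indicator_of_notMem hx]
    exact indicator_nonneg (fun _ _ => zero_le_one) _

theorem neg_stepLp_mem_Kcone {p : ℝ} (hp : p ≤ 0) : -stepLp p ∈ Kcone := by
  refine ⟨fun _ => -1, monotoneOn_const, ?_⟩
  filter_upwards [Lp.coeFn_neg (stepLp p), stepLp_ae p, ae_mem_Omg] with x h1 h2 h3
  rw [h1, Pi.neg_apply, h2, indicator_of_mem (show x ∈ Ioi p from hp.trans_lt h3.1)]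

theorem L2_integrable (W : L2) : Integrable W mu :=
  (Lp.memLp W).integrable (by norm_num)

theorem inner_eq_integral (W U : L2) : ⟪W, U⟫ = ∫ x, W x * U x ∂mu := by
  rw [L2.inner_def]
  refine integral_congr_ae (Eventually.of_forall fun x => ?_)
  simp [mul_comm]

theorem exists_truncation {X : L2} (hX : X ∈ Kcone) (c : ℝ) {n : ℝ} (hn : 0 < n) :
    ∃ Z ∈ Kcone, X - n⁻¹ • Z ∈ Kcone ∧ ∀ᵐ x ∂mu, Z x = max 0 (min (n * (X x - c)) 1) := by
  obtain ⟨g, hg, hgX⟩ := hX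
  set φ : ℝ → ℝ := fun y => max 0 (min (n * (y - c)) 1) with hφ
  have hφc : Continuous φ := by fun_prop
  have hmem : MemLp (fun x => φ (X x)) 2 mu := by
    refine MemLp.of_bound (hφc.comp_aestronglyMeasurable (Lp.aestronglyMeasurable X)) 1
      (Eventually.of_forall fun x => ?_)
    rw [Real.norm_of_nonneg (le_max_left _ _)]
    exact max_le zero_le_one (min_le_right _ _)
  have hae := hmem.coeFn_toLp
  have hφm : Monotone φ := fun a b hab =>
    max_le_max le_rfl (min_le_min (by nlinarith) le_rfl)
  have hφn : Monotone fun y => y - n⁻¹ * φ y := by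
    intro a b hab
    have h1 : φ b - φ a ≤ n * (b - a) := by
      have : 0 ≤ n * (b - a) := mul_nonneg hn.le (by linarith)
      simp only [hφ]
      rw [sub_le_iff_le_add]
      refine max_le (by have := le_max_left 0 (min (n * (a - c)) 1); linarith) ?_
      have h2 := le_max_right 0 (min (n * (a - c)) 1)
      refine le_trans ?_ (add_le_add_right h2 _)
      rcases le_total (n * (a - c)) 1 with h | h
      · rw [min_eq_left h]
        exact (min_le_left _ _).trans (by linarith)
      · rw [min_eq_right h]
        exact (min_le_right _ _).trans (by linarith)
    have h2 : n⁻¹ * (φ b - φ a) ≤ b - a := by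
      rwa [inv_mul_le_iff₀ hn]
    simp only
    linarith
  refine ⟨hmem.toLp _, ⟨fun x => φ (g x), fun x hx y hy hxy => hφm (hg hx hy hxy), ?_⟩,
    ⟨fun x => g x - n⁻¹ * φ (g x), fun x hx y hy hxy => hφn (hg hx hy hxy), ?_⟩, hae⟩
  · filter_upwards [hae, hgX] with x h1 h2
    rw [h1, h2]
  · filter_upwards [hae, hgX, Lp.coeFn_sub X (n⁻¹ • hmem.toLp _),
      Lp.coeFn_smul n⁻¹ (hmem.toLp _)] with x h1 h2 h3 h4
    rw [h3, Pi.sub_apply, h4, Pi.smul_apply, h1, h2, smul_eq_mul]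

/-- Normal vectors have vanishing integral over superlevel sets. -/
theorem integral_superlevel_eq_zero {X W : L2} (hX : X ∈ Kcone) (hW : W ∈ normalCone X) (c : ℝ) :
    ∫ x in {x | c < X x}, W x ∂mu = 0 := by
  have hXm : Measurable X := (Lp.stronglyMeasurable X).measurable
  have hms : MeasurableSet {x | c < X x} := measurableSet_lt measurable_const hXm
  have hW' := (mem_normalCone_iff hX).1 hW
  have h0 : ∀ n : ℕ, ∫ x, W x * max 0 (min (((n:ℝ) + 1) * (X x - c)) 1) ∂mu = 0 := by
    intro n
    have hn : (0:ℝ) < n + 1 := by positivity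
    obtain ⟨Z, hZ, hXZ, hZae⟩ := exists_truncation hX c hn
    have h1 : ⟪W, Z⟫ = 0 := by
      refine le_antisymm (hW'.2 Z hZ) ?_
      have h2 := hW'.2 _ hXZ
      rw [inner_sub_right, inner_smul_right, hW'.1, zero_sub, neg_nonpos] at h2
      exact nonneg_of_mul_nonneg_right h2 (by positivity)
    rw [inner_eq_integral] at h1
    refine Eq.trans (integral_congr_ae ?_) h1
    filter_upwards [hZae] with x hx
    rw [hx]
  rw [← integral_indicator hms]
  have hlim : Tendsto (fun n : ℕ => ∫ x, W x * max 0 (min (((n:ℝ) + 1) * (X x - c)) 1) ∂mu) atTop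
      (𝓝 (∫ x, {x | c < X x}.indicator (fun x => W x) x ∂mu)) := by
    refine tendsto_integral_of_dominated_convergence (fun x => ‖W x‖) ?_
      (L2_integrable W).norm ?_ ?_
    · intro n
      refine (Lp.aestronglyMeasurable W).mul (Measurable.aestronglyMeasurable ?_)
      fun_prop
    · intro n
      refine Eventually.of_forall fun x => ?_
      rw [norm_mul]
      refine mul_le_of_le_one_right (norm_nonneg _) ?_
      rw [Real.norm_of_nonneg (le_max_left _ _)]
      exact max_le zero_le_one (min_le_right _ _)
    · refine Eventually.of_forall fun x => ?_
      by_cases hx : c < X x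
      · rw [indicator_of_mem (show x ∈ {x | c < X x} from hx)]
        refine tendsto_const_nhds.congr' ?_
        obtain ⟨N, hN⟩ := exists_nat_gt ((X x - c)⁻¹)
        filter_upwards [eventually_ge_atTop N] with n hn
        have h1 : (1:ℝ) ≤ (n + 1) * (X x - c) := by
          have hpos : 0 < X x - c := sub_pos.2 hx
          have h2 : (X x - c)⁻¹ ≤ n + 1 := by
            have : (N:ℝ) ≤ n := by exact_mod_cast hn
            linarith
          calc (1:ℝ) = (X x - c)⁻¹ * (X x - c) := (inv_mul_cancel₀ hpos.ne').symm
            _ ≤ _ := by gcongr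
        rw [min_eq_right h1, max_eq_right zero_le_one, mul_one]
      · rw [indicator_of_notMem (show x ∉ {x | c < X x} from hx)]
        refine tendsto_const_nhds.congr fun n => ?_
        have h1 : ((n:ℝ) + 1) * (X x - c) ≤ 0 :=
          mul_nonpos_of_nonneg_of_nonpos (by positivity) (by linarith [not_lt.1 hx])
        rw [max_eq_left ((min_le_left _ _).trans h1), mul_zero]
  simp only [h0] at hlim
  exact tendsto_nhds_unique hlim tendsto_const_nhds

/-- Characterization of the polar cone of `K` by primitives. -/
theorem inner_nonpos_of_integral_Ioi_nonpos {W : L2} (h0 : ∫ x in Ioi (0:ℝ), W x ∂mu = 0)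
    (h : ∀ m : ℝ, ∫ x in Ioi m, W x ∂mu ≤ 0) : ∀ Z ∈ Kcone, ⟪W, Z⟫ ≤ 0 := by
  obtain ⟨P, hPK, hP⟩ := exists_projK
  set Q := P W with hQ
  have hQK := hPK W
  have hN : W - Q ∈ normalCone Q := hP W
  obtain ⟨g, hg, hgQ⟩ := hQK
  have hQm : Measurable Q := (Lp.stronglyMeasurable Q).measurable
  have hsub : ∀ s : Set ℝ, ∫ x in s, (W - Q : L2) x ∂mu =
      (∫ x in s, W x ∂mu) - ∫ x in s, Q x ∂mu := by
    intro s
    rw [← integral_sub (L2_integrable W).integrableOn (L2_integrable Q).integrableOn]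
    exact integral_congr_ae (ae_restrict_of_ae (Lp.coeFn_sub W Q))
  have hcompl : ∀ c, ∫ x in {x | c < Q x}, Q x ∂mu ≤ 0 := by
    intro c
    have h1 := integral_superlevel_eq_zero (hPK W) hN c
    obtain ⟨p, hp1, hp2⟩ := exists_superlevel_eq_Ioi hg c
    rw [hsub, setIntegral_congr_set (superlevel_ae_eq_Ioi hgQ hp1 hp2)] at h1
    linarith [h p]
  have htot : ∫ x, Q x ∂mu = 0 := by
    have h1 : (Ioi (0:ℝ) : Set ℝ) =ᵐ[mu] univ := by
      filter_upwards [ae_mem_Omg] with x hx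
      exact propext ⟨fun _ => trivial, fun _ => hx.1⟩
    have h2 := ((mem_normalCone_iff (hPK W)).1 hN).2 _ (stepLp_mem_Kcone 0)
    have h3 := ((mem_normalCone_iff (hPK W)).1 hN).2 _ (neg_stepLp_mem_Kcone le_rfl)
    rw [inner_neg_right] at h3
    have h4 : ⟪W - Q, stepLp 0⟫ = 0 := by linarith
    rw [inner_stepLp, hsub, h0, setIntegral_congr_set h1, setIntegral_univ] at h4
    linarith
  have hpos : ∀ᵐ x ∂mu, Q x ≤ 0 := by
    have hms : MeasurableSet {x | 0 < Q x} := measurableSet_lt measurable_const hQm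
    have h1 : ∫ x in {x | 0 < Q x}, Q x ∂mu = 0 := le_antisymm (hcompl 0)
      (setIntegral_nonneg hms fun x hx => le_of_lt hx)
    rw [setIntegral_eq_zero_iff_of_nonneg_ae ((ae_restrict_iff' hms).2
      (Eventually.of_forall fun x hx => le_of_lt hx)) (L2_integrable Q).integrableOn] at h1
    have h2 := (ae_restrict_iff' hms).1 h1
    filter_upwards [h2] with x hx
    by_contra! h3
    exact h3.ne' (hx h3)
  have hzero : Q =ᵐ[mu] 0 := by
    have h1 : ∫ x, (-⇑Q) x ∂mu = 0 := by
      simp only [Pi.neg_apply]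
      rw [integral_neg, htot, neg_zero]
    rw [integral_eq_zero_iff_of_nonneg_ae (by filter_upwards [hpos] with x hx; simpa using hx)
      (L2_integrable Q).neg] at h1
    filter_upwards [h1] with x hx
    simpa using hx
  have hQ0 : Q = 0 := (Lp.eq_zero_iff_ae_eq_zero).2 hzero
  intro Z hZ
  have := ((mem_normalCone_iff (hPK W)).1 hN).2 Z hZ
  rwa [hQ0, sub_zero] at this

end Cone

section LocallyConstant

/-- `U` is a.e. equal to `c` on an interval `(a, b) ⊆ Ω` containing `m`. -/
def EqConstNear (U : L2) (m c : ℝ) : Prop :=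
  ∃ a b, 0 ≤ a ∧ a < m ∧ m < b ∧ b ≤ 1 ∧ ∀ᵐ x ∂mu, x ∈ Ioo a b → U x = c

theorem mem_OmegaX_iff {U : L2} {m : ℝ} : m ∈ OmegaX U ↔ ∃ c, EqConstNear U m c := by
  constructor
  · rintro ⟨hm, s, hs, c, hc⟩
    obtain ⟨a, b, hab, hs'⟩ := mem_nhds_iff_exists_Ioo_subset.1 (inter_mem hs
      (isOpen_Ioo.mem_nhds hm : Omg ∈ 𝓝 m))
    have hab' : a < b := hab.1.trans hab.2
    have hO : Ioo a b ⊆ Ioo 0 1 := fun x hx => (hs' hx).2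
    rw [Ioo_subset_Ioo_iff hab'] at hO
    refine ⟨c, a, b, hO.1, hab.1, hab.2, hO.2, ?_⟩
    have h1 := ae_restrict_of_ae_restrict_of_subset (fun x hx => (hs' hx).1 : Ioo a b ⊆ s) hc
    exact (ae_restrict_iff' measurableSet_Ioo).1 h1
  · rintro ⟨c, a, b, ha, ham, hmb, hb, h⟩
    refine ⟨⟨ha.trans_lt ham, hmb.trans_le hb⟩, Ioo a b, Ioo_mem_nhds ham hmb, c, ?_⟩
    exact (ae_restrict_iff' measurableSet_Ioo).2 h

theorem OmegaX_subset_Omg (U : L2) : OmegaX U ⊆ Omg := fun _ h => h.1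

theorem EqConstNear.of_mem {U : L2} {a b c : ℝ} (ha : 0 ≤ a) (hb : b ≤ 1)
    (h : ∀ᵐ x ∂mu, x ∈ Ioo a b → U x = c) {m : ℝ} (hm : m ∈ Ioo a b) : EqConstNear U m c :=
  ⟨a, b, ha, hm.1, hm.2, hb, h⟩

theorem EqConstNear.unique {U : L2} {m c c' : ℝ} (h : EqConstNear U m c)
    (h' : EqConstNear U m c') : c = c' := by
  obtain ⟨a, b, ha, ham, hmb, hb, h⟩ := h
  obtain ⟨a', b', ha', ham', hmb', hb', h'⟩ := h'
  obtain ⟨x, hx, hx'⟩ := exists_mem_Ioo_of_ae (h.and h') ((max_lt ham ham').trans (lt_min hmb hmb'))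
    (ha.trans (le_max_left _ _)) ((min_le_left _ _).trans hb)
  rw [mem_Ioo, max_lt_iff, lt_min_iff] at hx'
  rw [← hx.1 ⟨hx'.1.1, hx'.2.1⟩, ← hx.2 ⟨hx'.1.2, hx'.2.2⟩]

theorem isOpen_OmegaX (U : L2) : IsOpen (OmegaX U) := by
  refine isOpen_iff_mem_nhds.2 fun m hm => ?_
  obtain ⟨c, a, b, ha, ham, hmb, hb, h⟩ := mem_OmegaX_iff.1 hm
  filter_upwards [Ioo_mem_nhds ham hmb] with x hx
  exact mem_OmegaX_iff.2 ⟨c, .of_mem ha hb h hx⟩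

open Classical in
/-- A representative of `U` which is locally constant on `Ω_U`. -/
def locVal (U : L2) (m : ℝ) : ℝ := if h : ∃ c, EqConstNear U m c then h.choose else U m

theorem EqConstNear.locVal_eq {U : L2} {m c : ℝ} (h : EqConstNear U m c) : locVal U m = c := by
  have h' : ∃ c, EqConstNear U m c := ⟨c, h⟩
  rw [locVal, dif_pos h']
  exact h'.choose_spec.unique h

theorem locVal_eq_of_isPreconnected {U : L2} {S : Set ℝ} (hS : IsPreconnected S)
    (hSU : S ⊆ OmegaX U) {x y : ℝ} (hx : x ∈ S) (hy : y ∈ S) : locVal U x = locVal U y := by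
  refine hS.induction₂ (fun x y => locVal U x = locVal U y) (fun x hx => ?_)
    (fun x y z _ _ _ => Eq.trans) (fun x y _ _ => Eq.symm) hx hy
  obtain ⟨c, a, b, ha, ham, hmb, hb, h⟩ := mem_OmegaX_iff.1 (hSU hx)
  refine mem_nhdsWithin_of_mem_nhds ?_
  filter_upwards [Ioo_mem_nhds ham hmb] with z hz
  rw [(EqConstNear.of_mem ha hb h ⟨ham, hmb⟩).locVal_eq, (EqConstNear.of_mem ha hb h hz).locVal_eq]

theorem ae_eq_locVal (U : L2) : U =ᵐ[mu] locVal U := by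
  refine measure_null_of_locally_null _ fun x hx => ?_
  have hxU : ∃ c, EqConstNear U x c := by
    by_contra h
    exact hx (show U x = locVal U x by rw [locVal, dif_neg h])
  obtain ⟨c, a, b, ha, ham, hmb, hb, h⟩ := hxU
  refine ⟨Ioo a b ∩ {x | U x ≠ c}, ?_, ?_⟩
  · refine mem_nhdsWithin_iff_exists_mem_nhds_inter.2 ⟨Ioo a b, Ioo_mem_nhds ham hmb, ?_⟩
    rintro y ⟨hy, hyU⟩
    refine ⟨hy, fun h' => hyU ?_⟩
    change U y = locVal U y
    rw [(EqConstNear.of_mem ha hb h hy).locVal_eq, h']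
  · refine measure_mono_null ?_ (ae_iff.1 h)
    exact fun y hy h' => hy.2 (h' hy.1)

theorem exists_const_of_Ioo_subset {U : L2} {a b : ℝ} (h : Ioo a b ⊆ OmegaX U) :
    ∃ c, ∀ᵐ x ∂mu, x ∈ Ioo a b → U x = c := by
  rcases (Ioo a b).eq_empty_or_nonempty with he | ⟨z, hz⟩
  · exact ⟨0, by simp [he]⟩
  refine ⟨locVal U z, ?_⟩
  filter_upwards [ae_eq_locVal U] with x hx hxab
  rw [hx, locVal_eq_of_isPreconnected isPreconnected_Ioo h hxab hz]

theorem mem_HX_iff {X U : L2} : U ∈ HX X ↔ OmegaX X ⊆ OmegaX U := by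
  constructor
  · rintro ⟨g, hg, h⟩ m hm
    have h1 : connectedComponentIn (OmegaX X) m ∈ 𝓝 m :=
      ((isOpen_OmegaX X).connectedComponentIn).mem_nhds (mem_connectedComponentIn hm)
    refine ⟨hm.1, _, h1, g m, ?_⟩
    rw [ae_restrict_iff' ((isOpen_OmegaX X).connectedComponentIn).measurableSet]
    filter_upwards [hg] with x hx hxm
    rw [hx, h m hm x hxm]
  · intro h
    refine ⟨locVal U, ae_eq_locVal U, fun m hm m' hm' => ?_⟩
    exact locVal_eq_of_isPreconnected isPreconnected_connectedComponentIn
      ((connectedComponentIn_subset _ _).trans h) hm' (mem_connectedComponentIn hm)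

theorem self_mem_HX (X : L2) : X ∈ HX X := mem_HX_iff.2 subset_rfl

theorem exists_Ioo_subset_of_mem_OmegaX {X : L2} {m : ℝ} (hm : m ∈ OmegaX X) :
    ∃ a b, 0 ≤ a ∧ a < m ∧ m < b ∧ b ≤ 1 ∧ Ioo a b ⊆ OmegaX X := by
  obtain ⟨c, a, b, ha, ham, hmb, hb, h⟩ := mem_OmegaX_iff.1 hm
  exact ⟨a, b, ha, ham, hmb, hb, fun x hx => mem_OmegaX_iff.2 ⟨c, .of_mem ha hb h hx⟩⟩

/-- A criterion for membership in `H_X` on small intervals. -/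
theorem mem_HX_of_forall_Ioo {X U : L2} (h : ∀ a b, 0 ≤ a → a < b → b ≤ 1 → Ioo a b ⊆ OmegaX X →
    ∃ c, ∀ᵐ x ∂mu, x ∈ Ioo a b → U x = c) : U ∈ HX X := by
  refine mem_HX_iff.2 fun m hm => ?_
  obtain ⟨a, b, ha, ham, hmb, hb, hab⟩ := exists_Ioo_subset_of_mem_OmegaX hm
  obtain ⟨c, hc⟩ := h a b ha (ham.trans hmb) hb hab
  exact mem_OmegaX_iff.2 ⟨c, a, b, ha, ham, hmb, hb, hc⟩

theorem exists_const_of_mem_HX {X U : L2} (h : U ∈ HX X) {a b : ℝ} (hab : Ioo a b ⊆ OmegaX X) :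
    ∃ c, ∀ᵐ x ∂mu, x ∈ Ioo a b → U x = c :=
  exists_const_of_Ioo_subset (hab.trans (mem_HX_iff.1 h))

theorem isClosed_HX (X : L2) : IsClosed (HX X) := by
  refine isSeqClosed_iff_isClosed.1 fun u U hu hU => ?_
  obtain ⟨ns, -, hns⟩ := exists_subseq_tendsto_ae hU
  refine mem_HX_of_forall_Ioo fun a b ha hab hb hX => ?_
  choose c hc using fun n => exists_const_of_mem_HX (hu n) hX
  have hS := (ae_all_iff.2 hc).and hns
  obtain ⟨z, hz, hzab⟩ := exists_mem_Ioo_of_ae hS hab ha hb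
  refine ⟨U z, ?_⟩
  filter_upwards [hS] with x hx hxab
  refine tendsto_nhds_unique (hx.2.congr fun i => ?_) hz.2
  rw [hx.1 _ hxab, hz.1 _ hzab]

/-- The closed subspace `H_X` as a submodule. -/
def HXsub (X : L2) : Submodule ℝ L2 where
  carrier := HX X
  zero_mem' := mem_HX_of_forall_Ioo fun a b _ _ _ _ => ⟨0, by
    filter_upwards [Lp.coeFn_zero ℝ 2 mu] with x hx _
    rw [hx, Pi.zero_apply]⟩
  add_mem' {A B} hA hB := mem_HX_of_forall_Ioo fun a b _ _ _ hX => by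
    obtain ⟨c, hc⟩ := exists_const_of_mem_HX hA hX
    obtain ⟨d, hd⟩ := exists_const_of_mem_HX hB hX
    refine ⟨c + d, ?_⟩
    filter_upwards [hc, hd, Lp.coeFn_add A B] with x h1 h2 h3 hx
    rw [h3, Pi.add_apply, h1 hx, h2 hx]
  smul_mem' r A hA := mem_HX_of_forall_Ioo fun a b _ _ _ hX => by
    obtain ⟨c, hc⟩ := exists_const_of_mem_HX hA hX
    refine ⟨r * c, ?_⟩
    filter_upwards [hc, Lp.coeFn_smul r A] with x h1 h3 hx
    rw [h3, Pi.smul_apply, h1 hx, smul_eq_mul]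

instance (X : L2) : CompleteSpace (HXsub X) := (isClosed_HX X).completeSpace_coe

/-- A point of a bounded open set lies in an interval of the set with endpoints outside. -/
theorem exists_component {O : Set ℝ} (hO : IsOpen O) (hO1 : O ⊆ Omg) {m : ℝ} (hm : m ∈ O) :
    ∃ a b, a < m ∧ m < b ∧ a ∉ O ∧ b ∉ O ∧ Ioo a b ⊆ O := by
  have hA : IsClosed (Oᶜ ∩ Iic m) := hO.isClosed_compl.inter isClosed_Iic
  have hB : IsClosed (Oᶜ ∩ Ici m) := hO.isClosed_compl.inter isClosed_Ici
  have hA0 : (Oᶜ ∩ Iic m).Nonempty := ⟨0, fun h => (hO1 h).1.false, (hO1 hm).1.le⟩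
  have hB0 : (Oᶜ ∩ Ici m).Nonempty := ⟨1, fun h => (hO1 h).2.false, (hO1 hm).2.le⟩
  have hAb : BddAbove (Oᶜ ∩ Iic m) := ⟨m, fun x hx => hx.2⟩
  have hBb : BddBelow (Oᶜ ∩ Ici m) := ⟨m, fun x hx => hx.2⟩
  have ha := hA.csSup_mem hA0 hAb
  have hb := hB.csInf_mem hB0 hBb
  refine ⟨_, _, lt_of_le_of_ne ha.2 (ne_of_mem_of_not_mem hm ha.1).symm,
    lt_of_le_of_ne hb.2 (ne_of_mem_of_not_mem hm hb.1), ha.1, hb.1, fun x hx => ?_⟩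
  · by_contra hxO
    rcases le_total x m with h | h
    · exact absurd (le_csSup hAb ⟨hxO, h⟩) (not_le.2 hx.1)
    · exact absurd (csInf_le hBb ⟨hxO, h⟩) (not_le.2 hx.2)

theorem stepLp_mem_HX {A : L2} {p : ℝ} (hp : p ∉ OmegaX A) : stepLp p ∈ HX A := by
  refine mem_HX_of_forall_Ioo fun a b _ hab _ hA => ?_
  rcases le_or_gt p a with h | h
  · refine ⟨1, ?_⟩
    filter_upwards [stepLp_ae p] with x hx hxab
    rw [hx, indicator_of_mem (show x ∈ Ioi p from h.trans_lt hxab.1)]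
  · have hb : b ≤ p := by
      by_contra! hb
      exact hp (hA ⟨h, hb⟩)
    refine ⟨0, ?_⟩
    filter_upwards [stepLp_ae p] with x hx hxab
    rw [hx, indicator_of_notMem (show x ∉ Ioi p from not_lt.2 (hxab.2.le.trans hb))]

end LocallyConstant

section Normal

instance : NullSingletonClass mu := inferInstanceAs (NullSingletonClass (volume.restrict Omg))

theorem setIntegral_Ioi_sub (W : L2) (a b : ℝ) :
    ∫ x in Ioi a, W x ∂mu - ∫ x in Ioi b, W x ∂mu = ∫ x in a..b, W x ∂mu :=
  intervalIntegral.integral_Ioi_sub_Ioi' (L2_integrable W).integrableOn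
    (L2_integrable W).integrableOn

theorem continuous_setIntegral_Ioi (W : L2) : Continuous fun m => ∫ x in Ioi m, W x ∂mu := by
  have h1 : (fun m => ∫ x in Ioi m, W x ∂mu) =
      fun m => (∫ x in Ioi (0:ℝ), W x ∂mu) - ∫ x in (0:ℝ)..m, W x ∂mu := by
    funext m
    rw [← setIntegral_Ioi_sub W 0 m]
    ring
  rw [h1]
  exact continuous_const.sub (intervalIntegral.continuous_primitive
    (fun a b => (L2_integrable W).intervalIntegrable) 0)

theorem ae_hasDerivAt_setIntegral_Ioi (W : L2) :
    ∀ᵐ x ∂mu, HasDerivAt (fun m => ∫ x in Ioi m, W x ∂mu) (-W x) x := by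
  have hw : Integrable (Omg.indicator W) volume :=
    (integrable_indicator_iff measurableSet_Ioo).2 (L2_integrable W)
  have h1 : (fun m => ∫ x in Ioi m, W x ∂mu) = fun m =>
      (∫ x in Ioi (0:ℝ), Omg.indicator W x) - ∫ x in (0:ℝ)..m, Omg.indicator W x := by
    funext m
    rw [← intervalIntegral.integral_Ioi_sub_Ioi' hw.integrableOn hw.integrableOn, sub_sub_cancel,
      show mu.restrict (Ioi m) = volume.restrict (Ioi m ∩ Omg) from
        Measure.restrict_restrict measurableSet_Ioi,
      setIntegral_indicator (show MeasurableSet Omg from measurableSet_Ioo)]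
  rw [h1]
  filter_upwards [ae_restrict_of_ae (LocallyIntegrable.ae_hasDerivAt_integral hw.locallyIntegrable), ae_mem_Omg]
    with x hx hxO
  have := (hx 0).const_sub (∫ x in Ioi (0:ℝ), Omg.indicator W x)
  rwa [indicator_of_mem hxO] at this

theorem ae_eq_zero_of_setIntegral_Ioi_eq_zero {W : L2} {s : Set ℝ}
    (h : ∀ m ∈ s, ∫ x in Ioi m, W x ∂mu = 0) : ∀ᵐ x ∂mu, x ∈ s → W x = 0 := by
  have hc : ∀ᵐ x ∂mu, x ∉ {x ∈ s | 𝓝[s ∩ Ioi x] x = ⊥} := by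
    refine measure_eq_zero_iff_ae_notMem.1 ?_
    exact countable_setOfPred_isolated_right_within.measure_zero mu
  filter_upwards [hc, ae_hasDerivAt_setIntegral_Ioi W] with x hx hd hxs
  have hne : (𝓝[s ∩ Ioi x] x).NeBot := ⟨fun h' => hx ⟨hxs, h'⟩⟩
  have h1 := (hasDerivAt_iff_tendsto_slope.1 hd).mono_left
    (nhdsWithin_mono x (show s ∩ Ioi x ⊆ {x}ᶜ from fun y hy => ne_of_gt hy.2))
  have h2 : Tendsto (slope (fun m => ∫ x in Ioi m, W x ∂mu) x) (𝓝[s ∩ Ioi x] x) (𝓝 0) := by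
    refine tendsto_const_nhds.congr' ?_
    filter_upwards [self_mem_nhdsWithin] with y hy
    rw [slope_def_field, h x hxs, h y hy.1, sub_zero, zero_div]
  exact neg_eq_zero.1 (tendsto_nhds_unique h1 h2)

theorem eq_zero_of_setIntegral_Ioi_eq_zero {W : L2} (h : ∀ m, ∫ x in Ioi m, W x ∂mu = 0) :
    W = 0 := by
  refine (Lp.eq_zero_iff_ae_eq_zero).2 ?_
  filter_upwards [ae_eq_zero_of_setIntegral_Ioi_eq_zero (s := univ) fun m _ => h m] with x hx
  exact hx trivial

theorem inner_eq_zero_of_mem_HX {X W : L2} (h : ∀ m ∉ OmegaX X, ∫ x in Ioi m, W x ∂mu = 0)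
    {U : L2} (hU : U ∈ HX X) : ⟪W, U⟫ = 0 := by
  have hint : Integrable (fun x => W x * U x) mu := (Lp.memLp U).integrable_mul (Lp.memLp W)
    |>.congr (Eventually.of_forall fun x => mul_comm _ _)
  set 𝒞 : Set (Set ℝ) := {s | ∃ a b, a < b ∧ a ∉ OmegaX X ∧ b ∉ OmegaX X ∧ Ioo a b ⊆ OmegaX X ∧
    s = Ioo a b} with h𝒞
  have hdisj : 𝒞.PairwiseDisjoint id := by
    rintro s ⟨a, b, hab, ha, hb, hO, rfl⟩ t ⟨a', b', hab', ha', hb', hO', rfl⟩ hne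
    refine disjoint_left.2 fun x hx hx' => hne ?_
    have h1 : a = a' := by
      refine le_antisymm ?_ ?_
      · by_contra! h; exact ha (hO' ⟨h, hx.1.trans hx'.2⟩)
      · by_contra! h; exact ha' (hO ⟨h, hx'.1.trans hx.2⟩)
    have h2 : b = b' := by
      refine le_antisymm ?_ ?_
      · by_contra! h; exact hb' (hO ⟨hx.1.trans hx'.2, h⟩)
      · by_contra! h; exact hb (hO' ⟨hx'.1.trans hx.2, h⟩)
    rw [h1, h2]
  have hcount : 𝒞.Countable := by
    refine hdisj.countable_of_isOpen ?_ ?_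
    · rintro s ⟨a, b, -, -, -, -, rfl⟩; exact isOpen_Ioo
    · rintro s ⟨a, b, hab, -, -, -, rfl⟩; exact nonempty_Ioo.2 hab
  have hUn : OmegaX X = ⋃ s : 𝒞, (s : Set ℝ) := by
    ext m
    simp only [mem_iUnion]
    constructor
    · intro hm
      obtain ⟨a, b, ham, hmb, ha, hb, hO⟩ :=
        exists_component (isOpen_OmegaX X) (OmegaX_subset_Omg X) hm
      exact ⟨⟨_, a, b, ham.trans hmb, ha, hb, hO, rfl⟩, ham, hmb⟩
    · rintro ⟨⟨s, a, b, hab, ha, hb, hO, rfl⟩, hm⟩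
      exact hO hm
  have hcompl : ∫ x in (OmegaX X)ᶜ, W x * U x ∂mu = 0 := by
    rw [setIntegral_congr_ae (g := fun _ => (0:ℝ)) (isOpen_OmegaX X).measurableSet.compl]
    · simp
    · filter_upwards [ae_eq_zero_of_setIntegral_Ioi_eq_zero (s := (OmegaX X)ᶜ) h] with x hx hxO
      rw [hx hxO, zero_mul]
  have hO : ∫ x in OmegaX X, W x * U x ∂mu = 0 := by
    have : Countable 𝒞 := hcount
    rw [hUn, integral_iUnion]
    · refine (tsum_congr ?_).trans tsum_zero
      rintro ⟨s, a, b, hab, ha, hb, hO, rfl⟩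
      obtain ⟨c, hc⟩ := exists_const_of_mem_HX hU hO
      have h1 : ∫ x in Ioo a b, W x * U x ∂mu = ∫ x in Ioo a b, W x * c ∂mu := by
        refine setIntegral_congr_ae measurableSet_Ioo ?_
        filter_upwards [hc] with x hx hxab
        rw [hx hxab]
      have h2 := setIntegral_Ioi_sub W a b
      rw [h a ha, h b hb, sub_zero, intervalIntegral.integral_of_le hab.le,
        integral_Ioc_eq_integral_Ioo] at h2
      simp only
      rw [h1, integral_mul_const, ← h2, zero_mul]
    · rintro ⟨s, a, b, -, -, -, -, rfl⟩; exact measurableSet_Ioo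
    · exact hdisj.subtype _ _
    · exact hint.integrableOn
  rw [inner_eq_integral, ← integral_add_compl (isOpen_OmegaX X).measurableSet hint, hO, hcompl,
    add_zero]

theorem setIntegral_Ioi_eq_zero_of_mem_normalCone {X W : L2} (hX : X ∈ Kcone)
    (hW : W ∈ normalCone X) {m : ℝ} (hm : m ∉ OmegaX X) : ∫ x in Ioi m, W x ∂mu = 0 := by
  have hW' := ((mem_normalCone_iff hX).1 hW).2
  rcases le_or_gt m 0 with h0 | h0
  · rw [← inner_stepLp]
    have h1 := hW' _ (neg_stepLp_mem_Kcone h0)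
    rw [inner_neg_right] at h1
    exact le_antisymm (hW' _ (stepLp_mem_Kcone m)) (by linarith)
  rcases le_or_gt 1 m with h1 | h1
  · refine setIntegral_measure_zero _ (measure_eq_zero_iff_ae_notMem.2 ?_)
    filter_upwards [ae_mem_Omg] with x hx hxm
    exact absurd (hx.2.trans_le h1) (not_lt.2 (le_of_lt hxm))
  obtain ⟨g, hg, hgX⟩ := id hX
  have hcl : IsClosed {p : ℝ | ∫ x in Ioi p, W x ∂mu = 0} :=
    isClosed_eq (continuous_setIntegral_Ioi W) continuous_const
  refine hcl.closure_subset (Metric.mem_closure_iff.2 fun ε hε => ?_)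
  obtain ⟨l, hl, hlm⟩ := exists_between (max_lt h0 (sub_lt_self m hε))
  obtain ⟨r, hmr, hr⟩ := exists_between (lt_min h1 (lt_add_of_pos_right m hε))
  rw [max_lt_iff] at hl
  rw [lt_min_iff] at hr
  have hlO : l ∈ Omg := ⟨hl.1, hlm.trans h1⟩
  have hrO : r ∈ Omg := ⟨h0.trans hmr, hr.1⟩
  have hlr : g l < g r := by
    refine lt_of_le_of_ne (hg hlO hrO (hlm.trans hmr).le) fun heq => hm ?_
    refine mem_OmegaX_iff.2 ⟨g l, l, r, hl.1.le, hlm, hmr, hr.1.le, ?_⟩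
    filter_upwards [hgX] with x hx hxlr
    have hxO : x ∈ Omg := ⟨hl.1.trans hxlr.1, hxlr.2.trans hr.1⟩
    rw [hx]
    exact le_antisymm ((hg hxO hrO hxlr.2.le).trans heq.ge) (hg hlO hxO hxlr.1.le)
  obtain ⟨p, hp1, hp2⟩ := exists_superlevel_eq_Ioi hg (g l)
  have h3 := integral_superlevel_eq_zero hX hW (g l)
  rw [setIntegral_congr_set (superlevel_ae_eq_Ioi hgX hp1 hp2)] at h3
  refine ⟨p, h3, ?_⟩
  have h4 := hp1 r hrO hlr
  have h5 := hp2 l hlO (lt_irrefl _)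
  rw [Real.dist_eq, abs_lt]
  constructor <;> linarith

theorem inner_eq_zero_of_mem_normalCone {X W : L2} (hX : X ∈ Kcone) (hW : W ∈ normalCone X)
    {U : L2} (hU : U ∈ HX X) : ⟪W, U⟫ = 0 :=
  inner_eq_zero_of_mem_HX (fun _ hm => setIntegral_Ioi_eq_zero_of_mem_normalCone hX hW hm) hU

theorem normalCone_subset {X X' : L2} (hX : X ∈ Kcone) (hX' : X' ∈ Kcone)
    (h : OmegaX X ⊆ OmegaX X') : normalCone X ⊆ normalCone X' := fun _ hW =>
  (mem_normalCone_iff hX').2 ⟨inner_eq_zero_of_mem_normalCone hX hW (mem_HX_iff.2 h),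
    ((mem_normalCone_iff hX).1 hW).2⟩

theorem IsProjHX.sub_mem_normalCone {A X P : L2} (h : IsProjHX A X P) (hA : A ∈ Kcone)
    (hX : X ∈ Kcone) : P - X ∈ normalCone A := by
  have horth : ∀ U ∈ HX A, ⟪P - X, U⟫ = 0 := fun U hU => by
    rw [← neg_sub, inner_neg_left, h.2 U hU, neg_zero]
  have h0 : ∀ m ∉ OmegaX A, ∫ x in Ioi m, (P - X : L2) x ∂mu = 0 := fun m hm => by
    rw [← inner_stepLp]
    exact horth _ (stepLp_mem_HX hm)
  refine (mem_normalCone_iff hA).2 ⟨horth A (self_mem_HX A),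
    inner_nonpos_of_integral_Ioi_nonpos (h0 0 fun h => h.1.1.false) fun m => ?_⟩
  by_cases hm : m ∈ OmegaX A
  swap
  · exact (h0 m hm).le
  obtain ⟨a, b, ham, hmb, ha, hb, hO⟩ :=
    exists_component (isOpen_OmegaX A) (OmegaX_subset_Omg A) hm
  obtain ⟨k, hk⟩ := exists_const_of_mem_HX h.1 hO
  obtain ⟨g, hg, hgX⟩ := hX
  have hW : ∀ᵐ x ∂mu, x ∈ Ioo a b → (P - X : L2) x = k - g x := by
    filter_upwards [hk, hgX, Lp.coeFn_sub P X] with x h1 h2 h3 hx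
    rw [h3, Pi.sub_apply, h1 hx, h2]
  have hmO : m ∈ Omg := hm.1
  rcases le_total k (g m) with hkm | hkm
  · have h1 := setIntegral_Ioi_sub (P - X) m b
    rw [h0 b hb, sub_zero, intervalIntegral.integral_of_le hmb.le,
      integral_Ioc_eq_integral_Ioo] at h1
    rw [h1]
    refine integral_nonpos_of_ae ((ae_restrict_iff' measurableSet_Ioo).2 ?_)
    filter_upwards [hW, ae_mem_Omg] with x hx hxO hxm
    rw [hx ⟨ham.trans hxm.1, hxm.2⟩]
    have := hg hmO hxO hxm.1.le
    simp only [Pi.zero_apply]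
    linarith
  · have h1 := setIntegral_Ioi_sub (P - X) a m
    rw [h0 a ha, zero_sub, intervalIntegral.integral_of_le ham.le,
      integral_Ioc_eq_integral_Ioo] at h1
    rw [← neg_nonneg, h1]
    refine integral_nonneg_of_ae ((ae_restrict_iff' measurableSet_Ioo).2 ?_)
    filter_upwards [hW, ae_mem_Omg] with x hx hxO hxm
    rw [hx ⟨hxm.1, hxm.2.trans hmb⟩]
    have := hg hxO hmO hxm.2.le
    simp only [Pi.zero_apply]
    linarith

theorem isProjHX_starProjection (A X : L2) : IsProjHX A X ((HXsub A).starProjection X) :=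
  ⟨Submodule.starProjection_apply_mem (HXsub A) X, fun U hU =>
    Submodule.starProjection_inner_eq_zero X U hU⟩

/-- The velocity of a differentiable curve in the cone belongs to `H_X`. -/
theorem mem_HX_of_hasDerivAt {X : ℝ → L2} {V : L2} {t : ℝ} (hX : ∀ᶠ s in 𝓝 t, X s ∈ Kcone)
    (hV : HasDerivAt X V t) : V ∈ HX (X t) := by
  set P := (HXsub (X t)).starProjection with hP
  have hXt : X t ∈ Kcone := hX.self_of_nhds
  have hPX : P (X t) = X t := Submodule.starProjection_eq_self_iff.2 (self_mem_HX (X t))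
  have hd : HasDerivAt (fun s => P (X s) - X s) (P V - V) t :=
    (P.hasFDerivAt.comp_hasDerivAt t hV).sub hV
  have hN : ∀ᶠ s in 𝓝 t, P (X s) - X s ∈ normalCone (X t) := by
    filter_upwards [hX] with s hs
    exact (isProjHX_starProjection (X t) (X s)).sub_mem_normalCone hXt hs
  obtain ⟨hl, hr⟩ := hasDerivAt_iff_tendsto_slope_left_right.1 hd
  have h1 : P V - V ∈ normalCone (X t) := by
    refine (isClosed_normalCone (X t)).mem_of_tendsto hr ?_
    filter_upwards [self_mem_nhdsWithin, mem_nhdsWithin_of_mem_nhds hN] with s hs hsN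
    rw [slope_def_module, hPX, sub_self, sub_zero]
    exact smul_mem_normalCone hsN (inv_nonneg.2 (sub_nonneg.2 (le_of_lt hs)))
  have h2 : -(P V - V) ∈ normalCone (X t) := by
    refine (isClosed_normalCone (X t)).mem_of_tendsto hl.neg ?_
    filter_upwards [self_mem_nhdsWithin, mem_nhdsWithin_of_mem_nhds hN] with s hs hsN
    rw [slope_def_module, hPX, sub_self, sub_zero, ← neg_smul]
    exact smul_mem_normalCone hsN (neg_nonneg.2 (inv_nonpos.2 (sub_nonpos.2 (le_of_lt hs))))
  have h3 : P V - V = 0 := by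
    refine eq_zero_of_setIntegral_Ioi_eq_zero fun m => ?_
    rw [← inner_stepLp]
    have h4 := ((mem_normalCone_iff hXt).1 h1).2 _ (stepLp_mem_Kcone m)
    have h5 := ((mem_normalCone_iff hXt).1 h2).2 _ (stepLp_mem_Kcone m)
    rw [inner_neg_left] at h5
    linarith
  exact Submodule.starProjection_eq_self_iff.1 (sub_eq_zero.1 h3)

end Normal

section Semigroup

theorem ContinuousOn.integral_sub_smul_eq {E : Type*} [NormedAddCommGroup E] [NormedSpace ℝ E]
    [CompleteSpace E] {f : ℝ → E} (hf : ContinuousOn f (Ici 0)) {T : ℝ} (hT : 0 ≤ T) :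
    ∫ r in Ioc 0 T, (T - r) • f r = ∫ r in Ioc 0 T, ∫ q in Ioc 0 r, f q := by
  have hJ := hf.continuousOn_integral_Ioc
  have hD := hJ.continuousOn_integral_Ioc
  have hsub : Icc 0 T ⊆ Ici 0 := Icc_subset_Ici_self
  have hlin : Continuous fun r : ℝ => T - r := by fun_prop
  have h1 := intervalIntegral.integral_eq_sub_of_hasDerivAt_of_le
    (f := fun r => (T - r) • (∫ q in Ioc 0 r, f q) + ∫ p in Ioc 0 r, ∫ q in Ioc 0 p, f q)
    (f' := fun r => (T - r) • f r) hT ((hlin.continuousOn.smul hJ).add hD |>.mono hsub) ?_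
    ((hlin.continuousOn.smul hf).intervalIntegrable_of_Ici le_rfl hT)
  · rw [intervalIntegral.integral_of_le hT] at h1
    simpa using h1
  · intro r hr
    have hr0 : 0 < r := hr.1
    have h2 := (((hasDerivAt_id r).const_sub T).smul (hf.hasDerivAt_integral_Ioc hr0)).add
      (hJ.hasDerivAt_integral_Ioc hr0)
    refine h2.congr_deriv ?_
    simp

theorem IsLagrangian.congr {E : Type*} [NormedAddCommGroup E] [InnerProductSpace ℝ E] {K : Set E}
    {F : E → E} {x v : E} {u u' : ℝ → E} (h : IsLagrangian K F x v u)
    (huu' : ∀ t, 0 ≤ t → u t = u' t) : IsLagrangian K F x v u' := by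
  refine ⟨fun t ht => huu' t ht ▸ h.1 t ht, (huu' 0 le_rfl).symm.trans h.2.1, fun T => ?_, ?_⟩
  · obtain ⟨C, hC⟩ := h.2.2.1 T
    exact ⟨C, fun a ha b hb => by rw [← huu' a ha.1, ← huu' b hb.1]; exact hC ha hb⟩
  · filter_upwards [h.2.2.2, ae_restrict_mem measurableSet_Ioi] with t ht ht0
    obtain ⟨V, hV, hVn⟩ := ht
    refine ⟨V, hV.congr_of_eventuallyEq ?_, ?_⟩
    · filter_upwards [Ioi_mem_nhds ht0] with s hs
      exact (huu' s (le_of_lt hs)).symm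
    · rw [← huu' t (le_of_lt ht0), setIntegral_congr_fun measurableSet_Ioc
        (g := fun s => F (u s)) fun s hs => by simp only [huu' s hs.1.le]]
      exact hVn

instance : SecondCountableTopology L2 := by
  have : Fact ((2 : ℝ≥0∞) ≠ ∞) := ⟨by simp⟩
  have : SFinite mu := by unfold mu; infer_instance
  exact Lp.SecondCountableTopology

variable {F : L2 → L2} {L : ℝ≥0} {x v : L2} {X : ℝ → L2}

theorem LagSol.isLagrangian (h : LagSol F x v X) : IsLagrangian Kcone F x v X := h

/-- Integration of the differential inclusion when the normal cones are controlled by the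
final one. -/
theorem LagSol.bracket_sub_mem_normalCone (h : LagSol F x v X) (hF : LipschitzOnWith L F Kcone)
    {T : ℝ} (hT : 0 ≤ T)
    (hN : ∀ᵐ r, r ∈ Ioo 0 T → normalCone (X r) ⊆ normalCone (X T)) :
    x + T • v + (∫ r in Ioc 0 T, (T - r) • F (X r)) - X T ∈ normalCone (X T) := by
  have hFc := h.isLagrangian.continuousOn_comp hF
  have hJ := hFc.continuousOn_integral_Ioc
  rw [hFc.integral_sub_smul_eq hT]
  intro Z hZ
  set D : ℝ → L2 := fun r => ∫ p in Ioc 0 r, ∫ q in Ioc 0 p, F (X q) with hD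
  set w : ℝ → L2 := fun r => x + r • v + D r - X r with hw
  obtain ⟨C, hC⟩ := h.2.2.1 T
  obtain ⟨C', hC'⟩ := hJ.exists_lipschitzOnWith_integral_Ioc T
  have hlin : LipschitzWith ‖v‖₊ fun r : ℝ => r • v := LipschitzWith.of_dist_le_mul fun a b => by
    rw [dist_eq_norm, ← sub_smul, norm_smul, mul_comm, ← dist_eq_norm]
    rfl
  have hwl := ((((LipschitzWith.const x).add hlin).lipschitzOnWith (s := Icc 0 T)).add hC').sub hC
  have h1 : AbsolutelyContinuousOnInterval (fun r => innerSL ℝ (Z - X T) (w r)) 0 T := by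
    have := (innerSL ℝ (Z - X T)).lipschitz.comp_lipschitzOnWith hwl
    rw [← uIcc_of_le hT] at this
    exact this.absolutelyContinuousOnInterval
  have h2 := h1.le_of_ae_hasDerivAt_nonpos hT ?_
  · have hw0 : w 0 = 0 := by simp [hw, hD, h.2.1]
    rw [hw0, map_zero, innerSL_apply_apply, real_inner_comm] at h2
    exact h2
  · have h3 := (ae_restrict_iff' measurableSet_Ioi).1 h.2.2.2
    filter_upwards [h3, hN] with r hr hrN hrm
    obtain ⟨V, hV, hVn⟩ := hr hrm.1
    have h4 : HasDerivAt w (v + (∫ q in Ioc 0 r, F (X q)) - V) r := by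
      have h5 := ((((hasDerivAt_id r).smul_const v).const_add x).add
        (hJ.hasDerivAt_integral_Ioc hrm.1)).sub hV
      refine h5.congr_deriv ?_
      simp
    refine ⟨_, ?_, (innerSL ℝ (Z - X T)).hasFDerivAt.comp_hasDerivAt r h4⟩
    rw [innerSL_apply_apply, real_inner_comm]
    exact hrN hrm hVn Z hZ

/-- Every solution whose initial velocity is compatible with the initial position preserves the
flat parts of its initial position. -/
def PreservesFlats (F : L2 → L2) : Prop :=
  ∀ Xb ∈ Kcone, ∀ Vb ∈ HX Xb, ∀ X : ℝ → L2, LagSol F Xb Vb X →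
    ∀ t : ℝ, 0 ≤ t → OmegaX Xb ⊆ OmegaX (X t)

/-- Restarting a solution at time `τ` with any compatible velocity. -/
theorem LagSol.restart (h : LagSol F x v X) (hF : LipschitzOnWith L F Kcone)
    (hmono : PreservesFlats F) {τ : ℝ} (hτ : 0 ≤ τ) {U : L2} (hU : U ∈ HX (X τ))
    (hN : (v + ∫ s in Ioc 0 τ, F (X s)) - U ∈ normalCone (X τ)) :
    LagSol F (X τ) U (fun t => X (t + τ)) := by
  obtain ⟨P, hPK, hP⟩ := exists_projK
  have hXτ := h.1 τ hτ
  obtain ⟨u, hu⟩ := IsLagrangian.exists_of_isProj hPK hP hF hXτ U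
  have hflat := hmono _ hXτ U hU u hu
  have h1 := hu.add_normal (w := (v + ∫ s in Ioc 0 τ, F (X s)) - U) fun t ht =>
    normalCone_subset hXτ (hu.1 t ht) (hflat t ht) hN
  rw [add_sub_cancel] at h1
  have h2 := h.isLagrangian.shift hF hτ
  exact hu.congr fun t ht => h1.unique h2 hF ht

theorem LagSol.right_deriv_eq (h : LagSol F x v X) (hF : LipschitzOnWith L F Kcone)
    (hmono : PreservesFlats F) {τ : ℝ} (hτ : 0 ≤ τ) {U V : L2} (hU : U ∈ HX (X τ))
    (hN : (v + ∫ s in Ioc 0 τ, F (X s)) - U ∈ normalCone (X τ))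
    (hV : HasDerivWithinAt X V (Ici τ) τ) : U = V := by
  have hXτ := h.1 τ hτ
  have h1 := h.restart hF hmono hτ hU hN
  have hflat : ∀ s, τ ≤ s → OmegaX (X τ) ⊆ OmegaX (X s) := fun s hs => by
    have := hmono _ hXτ U hU _ h1 (s - τ) (sub_nonneg.2 hs)
    rwa [sub_add_cancel] at this
  have hVH : V ∈ HXsub (X τ) := by
    have h2 := hasDerivWithinAt_iff_tendsto_slope.1 hV
    rw [Ici_sdiff_left] at h2
    refine (isClosed_HX (X τ)).mem_of_tendsto h2 ?_
    filter_upwards [self_mem_nhdsWithin] with s hs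
    rw [slope_def_module]
    exact (HXsub (X τ)).smul_mem _ ((HXsub (X τ)).sub_mem
      (mem_HX_iff.2 (hflat s (le_of_lt hs))) (self_mem_HX _))
  have hVN : (v + ∫ s in Ioc 0 τ, F (X s)) - V ∈ normalCone (X τ) := fun Z hZ =>
    h.isLagrangian.inner_right_deriv_le hF hτ hV hZ
  have hUV : U - V ∈ HX (X τ) := (HXsub (X τ)).sub_mem hU hVH
  have h3 := inner_eq_zero_of_mem_normalCone hXτ hN hUV
  have h4 := inner_eq_zero_of_mem_normalCone hXτ hVN hUV
  refine sub_eq_zero.1 ((inner_self_eq_zero (𝕜 := ℝ)).1 ?_)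
  calc ⟪U - V, U - V⟫ = ⟪(v + ∫ s in Ioc 0 τ, F (X s)) - V, U - V⟫ -
      ⟪(v + ∫ s in Ioc 0 τ, F (X s)) - U, U - V⟫ := by rw [← inner_sub_left]; congr 1; abel
    _ = 0 := by rw [h3, h4, sub_zero]

/-- At time `t` the free velocity splits into a vector of `H_{X(t)}` and a normal vector. -/
def Splits (F : L2 → L2) (v : L2) (X : ℝ → L2) (t : ℝ) : Prop :=
  ∃ U ∈ HX (X t), (v + ∫ s in Ioc 0 t, F (X s)) - U ∈ normalCone (X t)

theorem LagSol.ae_splits (h : LagSol F x v X) : ∀ᵐ t, t ∈ Ioi 0 → Splits F v X t := by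
  filter_upwards [(ae_restrict_iff' measurableSet_Ioi).1 h.2.2.2] with t ht ht0
  obtain ⟨V, hV, hVn⟩ := ht ht0
  refine ⟨V, mem_HX_of_hasDerivAt ?_ hV, hVn⟩
  filter_upwards [Ioi_mem_nhds ht0] with s hs
  exact h.1 s (le_of_lt hs)

theorem Splits.flat (hs : Splits F v X s₀) (h : LagSol F x v X) (hF : LipschitzOnWith L F Kcone)
    (hmono : PreservesFlats F) (h0 : 0 ≤ s₀) {t : ℝ} (ht : s₀ ≤ t) :
    OmegaX (X s₀) ⊆ OmegaX (X t) := by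
  obtain ⟨U, hU, hUN⟩ := hs
  have := hmono _ (h.1 s₀ h0) U hU _ (h.restart hF hmono h0 hU hUN) (t - s₀) (sub_nonneg.2 ht)
  rwa [sub_add_cancel] at this

theorem integral_Ioc_comp_add_right {E : Type*} [NormedAddCommGroup E] [NormedSpace ℝ E]
    (f : ℝ → E) {s t : ℝ} (hst : s ≤ t) : ∫ r in Ioc 0 (t - s), f (r + s) = ∫ r in Ioc s t, f r := by
  rw [← intervalIntegral.integral_of_le (sub_nonneg.2 hst), ← intervalIntegral.integral_of_le hst,
    intervalIntegral.integral_comp_add_right, zero_add, sub_add_cancel]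

theorem LagSol.bracket_sub_mem (h : LagSol F x v X) (hF : LipschitzOnWith L F Kcone)
    (hmono : PreservesFlats F) {s t : ℝ} (hs : 0 ≤ s) (hst : s ≤ t) {U : L2} (hU : U ∈ HX (X s))
    (hN : (v + ∫ r in Ioc 0 s, F (X r)) - U ∈ normalCone (X s)) :
    X s + (t - s) • U + (∫ r in Ioc s t, (t - r) • F (X r)) - X t ∈ normalCone (X t) := by
  have h1 := h.restart hF hmono hs hU hN
  have h2 := h1.bracket_sub_mem_normalCone hF (sub_nonneg.2 hst) ?_
  · have h3 := integral_Ioc_comp_add_right (fun r => (t - r) • F (X r)) hst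
    simp only [sub_add_cancel] at h2
    rw [← h3]
    simpa only [← sub_sub, sub_right_comm t s] using h2
  · have h3 := (measurePreserving_add_right volume s).quasiMeasurePreserving.ae h.ae_splits
    filter_upwards [h3] with r hr hrm
    have hrs : 0 < r + s := by linarith [hrm.1]
    have hrt : r + s ≤ t := by linarith [hrm.2]
    simp only [sub_add_cancel]
    exact normalCone_subset (h.1 _ hrs.le) (h.1 _ (hs.trans hst))
      ((hr hrs).flat h hF hmono hrs.le hrt)

theorem LagSol.splits (h : LagSol F x v X) (hF : LipschitzOnWith L F Kcone)
    (hmono : PreservesFlats F) {τ : ℝ} (hτ : 0 < τ) : Splits F v X τ := by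
  have hXτ := h.1 τ hτ.le
  have hFc := h.isLagrangian.continuousOn_comp hF
  set P := (HXsub (X τ)).starProjection with hP
  set Q : L2 →L[ℝ] L2 := ContinuousLinearMap.id ℝ L2 - P with hQ
  have hQH : ∀ W ∈ HX (X τ), Q W = 0 := fun W hW => by
    have : P W = W := Submodule.starProjection_eq_self_iff.2 hW
    simp [hQ, this]
  have hQN : ∀ W ∈ normalCone (X τ), Q W = W := fun W hW => by
    have : P W = 0 := (Submodule.starProjection_apply_eq_zero_iff _).2
      ((Submodule.mem_orthogonal' _ _).2 fun U hU => inner_eq_zero_of_mem_normalCone hXτ hW hU)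
    simp [hQ, this]
  set Y : ℝ → L2 := fun s => v + ∫ r in Ioc 0 s, F (X r) with hY
  set G : ℝ → L2 := fun s => ∫ r in Ioc s τ, (τ - r) • F (X r) with hG
  have hkey : ∀ s, 0 < s → s < τ → Splits F v X s →
      Q (Y s + (τ - s)⁻¹ • G s) ∈ normalCone (X τ) := by
    intro s hs hsτ hsplit
    obtain ⟨U, hU, hUN⟩ := id hsplit
    have hd : 0 < τ - s := sub_pos.2 hsτ
    have h1 := h.bracket_sub_mem hF hmono hs.le hsτ.le hU hUN
    have h2 := (isProjHX_starProjection (X τ) (X s)).sub_mem_normalCone hXτ (h.1 s hs.le)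
    have h3 := add_mem_normalCone h1 h2
    have h4 := normalCone_subset (h.1 s hs.le) hXτ (hsplit.flat h hF hmono hs.le hsτ.le) hUN
    have h5 := smul_mem_normalCone h3 (inv_nonneg.2 hd.le)
    have h6 := add_mem_normalCone h4 h5
    have h7 := hQN _ h6
    rw [← h7] at h6
    convert h6 using 1
    have e1 := hQH _ (Submodule.starProjection_apply_mem (HXsub (X τ)) (X s))
    have e2 := hQH _ (self_mem_HX (X τ))
    simp only [map_add, map_sub, map_smul, e1, e2, smul_add, smul_sub, smul_smul,
      inv_mul_cancel₀ hd.ne', one_smul, smul_zero, hY, hG]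
    abel
  have hfreq : ∃ᶠ s in 𝓝[<] τ, Q (Y s + (τ - s)⁻¹ • G s) ∈ normalCone (X τ) := by
    intro hev
    have h1 : ∀ᶠ s in 𝓝[<] τ, 0 < s := mem_nhdsWithin_of_mem_nhds (Ioi_mem_nhds hτ)
    obtain ⟨l, hl, hlτ⟩ := mem_nhdsLT_iff_exists_Ioo_subset.1 (hev.and h1)
    have h2 : volume (Ioo l τ) = 0 := by
      refine measure_mono_null (fun s hs => ?_) (ae_iff.1 h.ae_splits)
      have h3 := hlτ hs
      exact fun hsp => h3.1 (hkey s h3.2 hs.2 (hsp h3.2))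
    rw [Real.volume_Ioo, ENNReal.ofReal_eq_zero] at h2
    have : l < τ := hl
    linarith
  obtain ⟨M, hM⟩ := (isCompact_Icc (a := (0:ℝ)) (b := τ)).exists_bound_of_continuousOn
    (hFc.mono Icc_subset_Ici_self)
  have hGlim : Tendsto (fun s => (τ - s)⁻¹ • G s) (𝓝[<] τ) (𝓝 0) := by
    have h1 : Tendsto (fun s => M * (τ - s)) (𝓝[<] τ) (𝓝 0) := by
      have : Tendsto (fun s => M * (τ - s)) (𝓝 τ) (𝓝 (M * (τ - τ))) :=
        (by fun_prop : Continuous fun s => M * (τ - s)).tendsto τ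
      rw [sub_self, mul_zero] at this
      exact this.mono_left nhdsWithin_le_nhds
    refine squeeze_zero_norm' ?_ h1
    filter_upwards [self_mem_nhdsWithin, mem_nhdsWithin_of_mem_nhds (Ioi_mem_nhds hτ)] with s hs hs0
    have hd : 0 < τ - s := sub_pos.2 hs
    have h2 : ‖G s‖ ≤ ((τ - s) * M) * (τ - s) := by
      have h3 := norm_setIntegral_le_of_norm_le_const (μ := volume) (s := Ioc s τ)
        (f := fun r => (τ - r) • F (X r)) (C := (τ - s) * M) (by simp) fun r hr => ?_
      · rwa [Real.volume_real_Ioc_of_le (le_of_lt hs)] at h3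
      · rw [norm_smul, Real.norm_of_nonneg (sub_nonneg.2 hr.2)]
        exact mul_le_mul (by linarith [hr.1]) (hM r ⟨(le_of_lt hs0).trans hr.1.le, hr.2⟩)
          (norm_nonneg _) hd.le
    rw [norm_smul, norm_inv, Real.norm_of_nonneg hd.le, inv_mul_le_iff₀ hd]
    linarith
  have hYlim : Tendsto Y (𝓝[<] τ) (𝓝 (Y τ)) :=
    ((continuousOn_const.add hFc.continuousOn_integral_Ioc).continuousAt
      (Ici_mem_nhds hτ)).tendsto.mono_left nhdsWithin_le_nhds
  have hlim := (Q.continuous.tendsto _).comp (hYlim.add hGlim)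
  rw [add_zero] at hlim
  exact ⟨P (Y τ), Submodule.starProjection_apply_mem (HXsub (X τ)) (Y τ),
    (isClosed_normalCone (X τ)).mem_of_frequently_of_tendsto hfreq hlim⟩

theorem isProjK_of_sub_mem_normalCone {Z P : L2} (hP : P ∈ Kcone) (h : Z - P ∈ normalCone P) :
    IsProjK Z P := by
  refine ⟨hP, fun Y hY => ?_⟩
  have h1 := h Y hY
  have h2 : ‖Y - Z‖ ^ 2 = ‖Y - P‖ ^ 2 - 2 * ⟪Z - P, Y - P⟫ + ‖Z - P‖ ^ 2 := by
    rw [real_inner_comm, ← norm_sub_sq_real, sub_sub_sub_cancel_right]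
  rw [norm_sub_rev P Z]
  refine le_of_sq_le_sq ?_ (norm_nonneg _)
  nlinarith [sq_nonneg ‖Y - P‖]

end Semigroup

/-- **Semigroup property.** Suppose `F` is Lipschitz (and linearly bounded)
and sticking, and `Ω_{X̄} ⊆ Ω_{X(t)}` for all `t ≥ 0` for every Lagrangian solution
starting from `(X̄, V̄) ∈ K × H_{X̄}`. Then every such Lagrangian solution (with right
derivative `V`) is sticky, the shifted curve `t ↦ X(t+τ)` is the unique Lagrangian solution
with data `(X(τ), V(τ))`, and the projection formulas
`X(t) = P_K(X(t₁) + (t−t₁)V(t₁) + ∫_{t₁}^t (t−s)F[X(s)] ds)` and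
`V(t) = P_{H_{X(t)}}(V(t₁) + ∫_{t₁}^t F[X(s)] ds)` hold for `0 ≤ t₁ ≤ t`. -/
theorem stmt13 (F : L2 → L2) (L : ℝ≥0) (hLip : LipschitzOnWith L F Kcone)
    (C : ℝ) (hC : 0 ≤ C) (hbd : ∀ X ∈ Kcone, ‖F X‖ ≤ C * (1 + ‖X‖))
    (hstick : Sticking F)
    (hmono : ∀ Xb ∈ Kcone, ∀ Vb ∈ HX Xb, ∀ X : ℝ → L2, LagSol F Xb Vb X →
      ∀ t : ℝ, 0 ≤ t → OmegaX Xb ⊆ OmegaX (X t)) :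
    ∀ Xbar ∈ Kcone, ∀ Vbar ∈ HX Xbar, ∀ X V : ℝ → L2,
      LagSol F Xbar Vbar X →
      (∀ t : ℝ, 0 ≤ t → HasDerivWithinAt X (V t) (Set.Ici t) t) →
      StickyCurve X ∧
      (∀ τ : ℝ, 0 < τ →
        LagSol F (X τ) (V τ) (fun t => X (t + τ)) ∧
        (∀ X' : ℝ → L2, LagSol F (X τ) (V τ) X' →
          ∀ t : ℝ, 0 ≤ t → X' t = X (t + τ))) ∧
      (∀ t₁ t : ℝ, 0 ≤ t₁ → t₁ ≤ t →
        IsProjK (X t₁ + (t - t₁) • V t₁ +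
          ∫ s in Set.Ioc t₁ t, (t - s) • F (X s)) (X t) ∧
        IsProjHX (X t) (V t₁ + ∫ s in Set.Ioc t₁ t, F (X s)) (V t)) := by
  intro Xbar hXb Vbar hVb X V h hV
  have hsp : ∀ τ, 0 ≤ τ → Splits F Vbar X τ := by
    intro τ hτ
    rcases hτ.eq_or_lt with rfl | hτ
    · refine ⟨Vbar, h.2.1.symm ▸ hVb, fun Z _ => ?_⟩
      simp
    · exact h.splits hLip hmono hτ
  have hVs : ∀ τ, 0 ≤ τ → V τ ∈ HX (X τ) ∧
      (Vbar + ∫ s in Ioc 0 τ, F (X s)) - V τ ∈ normalCone (X τ) := by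
    intro τ hτ
    obtain ⟨U, hU, hN⟩ := hsp τ hτ
    rw [← h.right_deriv_eq hLip hmono hτ hU hN (hV τ hτ)]
    exact ⟨hU, hN⟩
  have hflat : StickyCurve X := fun s t hs hst => (hsp s hs).flat h hLip hmono hs hst
  refine ⟨hflat, fun τ hτ => ?_, fun s t hs hst => ?_⟩
  · have h1 := h.restart hLip hmono hτ.le (hVs τ hτ.le).1 (hVs τ hτ.le).2
    exact ⟨h1, fun X' h' t ht => h'.isLagrangian.unique h1.isLagrangian hLip ht⟩
  · have ht := hs.trans hst
    refine ⟨isProjK_of_sub_mem_normalCone (h.1 t ht)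
      (h.bracket_sub_mem hLip hmono hs hst (hVs s hs).1 (hVs s hs).2), (hVs t ht).1, fun U hU => ?_⟩
    have hFc := h.isLagrangian.continuousOn_comp hLip
    have h1 := inner_eq_zero_of_mem_normalCone (h.1 t ht) (hVs t ht).2 hU
    have h2 := inner_eq_zero_of_mem_normalCone (h.1 t ht)
      (normalCone_subset (h.1 s hs) (h.1 t ht) (hflat s t hs hst) (hVs s hs).2) hU
    rw [← hFc.integral_Ioc_sub_integral_Ioc hs hst]
    calc _ = ⟪(Vbar + ∫ r in Ioc 0 t, F (X r)) - V t, U⟫ -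
        ⟪(Vbar + ∫ r in Ioc 0 s, F (X r)) - V s, U⟫ := by rw [← inner_sub_left]; congr 1; abel
      _ = 0 := by rw [h1, h2, sub_zero]
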